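/- arXiv:1906.08046 — 3 statements merged into one kernel-verified Lean document; each statement's English description precedes it below -/
import Mathlib

section
/- Let G be a finite cyclic group of order N and m a squarefree divisor of N. For every x ∈ G, the Vinogradov sum θ(m) Σ_{d|m} (μ(d)/φ(d)) Σ_{χ of order d} χ(x), where θ(m) = φ(m)/m, equals 1 if x is m-free and 0 otherwise. -/
open ArithmeticFunction

theorem exists_monoidHom_pow_eq_one_apply_ne_one {G : Type*} [CommGroup G] [Finite G] {d : ℕ}
    {x : G} (hx : ¬ ∃ y : G, y ^ d = x) : ∃ χ : G →* ℂˣ, χ ^ d = 1 ∧ χ x ≠ 1 := by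
  have hx' : x ∉ (powMonoidHom d : G →* G).range := fun ⟨y, hy⟩ ↦ hx ⟨y, hy⟩
  have : NeZero (Monoid.exponent G) := ⟨Monoid.exponent_ne_zero_of_finite⟩
  rw [← CommGroup.forall_monoidHom_apply_eq_one_iff (M := ℂ)] at hx'
  push Not at hx'
  obtain ⟨χ, h, hχ⟩ := hx'
  refine ⟨χ, MonoidHom.ext fun y ↦ ?_, hχ⟩
  simpa using h (y ^ d) ⟨y, rfl⟩

theorem card_monoidHom_pow_eq_one {G : Type*} [CommGroup G] [Fintype G] [IsCyclic G]
    [Fintype (G →* ℂˣ)] [DecidableEq (G →* ℂˣ)] {d : ℕ} (hd : d ∣ Fintype.card G) :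
    (Finset.univ.filter fun χ : G →* ℂˣ ↦ χ ^ d = 1).card = d := by
  have : NeZero (Monoid.exponent G) := ⟨Monoid.exponent_ne_zero_of_finite⟩
  obtain ⟨e⟩ := CommGroup.monoidHom_mulEquiv_of_hasEnoughRootsOfUnity G ℂ
  have : IsCyclic (G →* ℂˣ) := isCyclic_of_surjective e.symm e.symm.surjective
  have hcard : Fintype.card (G →* ℂˣ) = Fintype.card G := Fintype.card_congr e.toEquiv
  have hd0 : d ≠ 0 := ne_zero_of_dvd_ne_zero Fintype.card_ne_zero hd
  refine (sum_card_orderOf_eq_card_pow_eq_one (G := G →* ℂˣ) hd0).symm.trans ?_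
  conv_rhs => rw [← Nat.sum_totient d]
  refine Finset.sum_congr (by ext; simp [hd0]) fun k hk ↦ ?_
  have hk' : k ∣ d := by simp_all
  exact IsCyclic.card_orderOf_eq_totient (by simpa [hcard] using hk'.trans hd)

open Classical in
theorem sum_monoidHom_pow_eq_one {G : Type*} [CommGroup G] [Fintype G] [IsCyclic G]
    [Fintype (G →* ℂˣ)] {d : ℕ} (hd : d ∣ Fintype.card G) (x : G) :
    ∑ χ : G →* ℂˣ with χ ^ d = 1, ((χ x : ℂˣ) : ℂ) = if ∃ y : G, y ^ d = x then (d : ℂ) else 0 := by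
  split_ifs with hx
  · obtain ⟨y, rfl⟩ := hx
    conv_rhs => rw [← card_monoidHom_pow_eq_one hd]
    rw [Finset.card_eq_sum_ones, Nat.cast_sum]
    refine Finset.sum_congr rfl fun χ hχ ↦ ?_
    have h : χ ^ d = 1 := by simpa using hχ
    simpa using congrArg Units.val (DFunLike.congr_fun h y)
  · obtain ⟨ψ, hψ, hne⟩ := exists_monoidHom_pow_eq_one_apply_ne_one hx
    refine eq_zero_of_mul_eq_self_left (b := ((ψ x : ℂˣ) : ℂ)) (by simpa using hne) ?_
    rw [Finset.mul_sum]
    exact Finset.sum_equiv (Equiv.mulLeft ψ) (by simp [mul_pow, hψ]) (by simp)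

theorem sum_divisors_sum_orderOf_eq {Γ R : Type*} [Group Γ] [Fintype Γ] [DecidableEq Γ]
    [AddCommMonoid R] (f : Γ → R) {d : ℕ} (hd : d ≠ 0) :
    ∑ e ∈ d.divisors, ∑ g, (if orderOf g = e then f g else 0) = ∑ g with g ^ d = 1, f g := by
  rw [Finset.sum_comm, Finset.sum_filter]
  refine Finset.sum_congr rfl fun g _ ↦ ?_
  simp [hd, orderOf_dvd_iff_pow_eq_one]

open Classical in
/-- The arithmetic function `n ↦ n` if `x` is an `n`-th power, and `0` otherwise. -/
noncomputable def powIndicator {G : Type*} [Group G] (x : G) : ArithmeticFunction ℂ :=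
  ⟨fun n ↦ if ∃ y : G, y ^ n = x then (n : ℂ) else 0, by simp⟩

theorem exists_pow_mul_eq_iff {G : Type*} [CommGroup G] {a b : ℕ} (h : a.Coprime b) (x : G) :
    (∃ y : G, y ^ (a * b) = x) ↔ (∃ y : G, y ^ a = x) ∧ ∃ y : G, y ^ b = x := by
  constructor
  · rintro ⟨y, rfl⟩
    exact ⟨⟨y ^ b, by rw [← pow_mul, mul_comm]⟩, ⟨y ^ a, by rw [← pow_mul]⟩⟩
  · rintro ⟨⟨y, hy⟩, z, hz⟩
    refine ⟨z ^ a.gcdA b * y ^ a.gcdB b, ?_⟩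
    have hbez : (a : ℤ) * a.gcdA b + b * a.gcdB b = 1 := by
      rw [← Nat.gcd_eq_gcd_ab, h.gcd_eq_one, Nat.cast_one]
    have hz' : (z ^ a.gcdA b) ^ (a * b) = x ^ (a * a.gcdA b) := by
      rw [← hz, ← zpow_natCast, ← zpow_natCast, ← zpow_mul, ← zpow_mul]
      push_cast
      ring_nf
    have hy' : (y ^ a.gcdB b) ^ (a * b) = x ^ (b * a.gcdB b) := by
      rw [← hy, ← zpow_natCast, ← zpow_natCast, ← zpow_mul, ← zpow_mul]
      push_cast
      ring_nf
    rw [mul_pow, hz', hy', ← zpow_add, hbez, zpow_one]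

theorem isMultiplicative_powIndicator {G : Type*} [CommGroup G] (x : G) :
    (powIndicator x).IsMultiplicative := by
  refine ⟨by simp [powIndicator], fun {a b} h ↦ ?_⟩
  classical
  simp only [powIndicator, coe_mk, Nat.cast_mul, ite_zero_mul_ite_zero]
  exact if_congr (exists_pow_mul_eq_iff h x) rfl rfl

/-- Euler's totient as a complex-valued arithmetic function. -/
noncomputable def complexTotient : ArithmeticFunction ℂ :=
  ⟨fun n ↦ (n.totient : ℂ), by simp⟩

theorem isMultiplicative_complexTotient : complexTotient.IsMultiplicative :=
  ⟨by simp [complexTotient], fun h ↦ by simp [complexTotient, Nat.totient_mul h]⟩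

theorem sum_orderOf_eq_moebius_mul_powIndicator {G : Type*} [CommGroup G] [Fintype G] [IsCyclic G]
    [Fintype (G →* ℂˣ)] {d : ℕ} (hd : d ∣ Fintype.card G) (x : G) :
    ∑ χ : G →* ℂˣ, (if orderOf χ = d then ((χ x : ℂˣ) : ℂ) else 0) =
      ((moebius : ArithmeticFunction ℂ) * powIndicator x) d := by
  classical
  have hpos : 0 < d := Nat.pos_of_dvd_of_pos hd Fintype.card_pos
  simp only [mul_apply, intCoe_apply]
  refine ((sum_eq_iff_sum_mul_moebius_eq_on (R := ℂ)
    (f := fun d ↦ ∑ χ : G →* ℂˣ, (if orderOf χ = d then ((χ x : ℂˣ) : ℂ) else 0))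
    (g := powIndicator x) {n | n ∣ Fintype.card G}
    (fun _ _ ↦ Nat.dvd_trans)).1 (fun n hn hnG ↦ ?_) d hpos hd).symm
  rw [sum_divisors_sum_orderOf_eq _ hn.ne', sum_monoidHom_pow_eq_one hnG]
  simp only [powIndicator, coe_mk]
  congr

theorem moebius_mul_apply_prime {R : Type*} [CommRing R] (f : ArithmeticFunction R) {p : ℕ}
    (hp : p.Prime) : ((moebius : ArithmeticFunction R) * f) p = f p - f 1 := by
  rw [mul_apply, Nat.sum_divisorsAntidiagonal fun i j ↦ (moebius : ArithmeticFunction R) i * f j,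
    hp.sum_divisors]
  simp [moebius_apply_prime hp, Nat.div_self hp.pos]
  ring

theorem forall_dvd_pow_iff_forall_primeFactors {G : Type*} [Group G] {m : ℕ} (hm : m ≠ 0) (x : G) :
    (∀ d : ℕ, d ∣ m → (∃ y : G, y ^ d = x) → d = 1) ↔
      ∀ p ∈ m.primeFactors, ¬ ∃ y : G, y ^ p = x := by
  constructor
  · intro h p hp hy
    exact (Nat.prime_of_mem_primeFactors hp).ne_one (h p (Nat.dvd_of_mem_primeFactors hp) hy)
  · rintro h d hd ⟨y, rfl⟩
    by_contra hne
    refine h d.minFac (Nat.mem_primeFactors.2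
      ⟨Nat.minFac_prime hne, (Nat.minFac_dvd d).trans hd, hm⟩) ⟨y ^ (d / d.minFac), ?_⟩
    rw [← pow_mul, Nat.div_mul_cancel (Nat.minFac_dvd d)]

theorem totient_div_eq_prod_primeFactors {m : ℕ} (hm : m ≠ 0) :
    (m.totient : ℂ) / m = ∏ p ∈ m.primeFactors, (1 - (p : ℂ)⁻¹) := by
  rw [div_eq_iff (Nat.cast_ne_zero.2 hm), mul_comm]
  simpa using congrArg (Rat.cast : ℚ → ℂ) (Nat.totient_eq_mul_prod_factors m)

open Classical in
theorem totient_div_mul_sum_eq_ite {G : Type*} [CommGroup G] [Fintype G] [IsCyclic G]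
    [Fintype (G →* ℂˣ)] {m : ℕ} (hm : m ∣ Fintype.card G) (hsq : Squarefree m) (x : G) :
    ((m.totient : ℂ) / m) *
        ∑ d ∈ m.divisors, ((moebius d : ℂ) / (Nat.totient d : ℂ)) *
          ∑ χ : G →* ℂˣ, (if orderOf χ = d then ((χ x : ℂˣ) : ℂ) else 0) =
      if ∀ d : ℕ, d ∣ m → (∃ y : G, y ^ d = x) → d = 1 then 1 else 0 := by
  have hsum : ∑ d ∈ m.divisors, ((moebius d : ℂ) / (Nat.totient d : ℂ)) *
      ∑ χ : G →* ℂˣ, (if orderOf χ = d then ((χ x : ℂˣ) : ℂ) else 0) =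
      ∑ d ∈ m.divisors, (moebius d : ℂ) *
        (pdiv ((moebius : ArithmeticFunction ℂ) * powIndicator x) complexTotient) d := by
    refine Finset.sum_congr rfl fun d hd ↦ ?_
    rw [sum_orderOf_eq_moebius_mul_powIndicator ((Nat.dvd_of_mem_divisors hd).trans hm), pdiv_apply]
    simp only [complexTotient, coe_mk]
    ring
  have hmul : (pdiv ((moebius : ArithmeticFunction ℂ) * powIndicator x)
      complexTotient).IsMultiplicative :=
    (isMultiplicative_moebius.intCast.mul (isMultiplicative_powIndicator x)).pdiv
      isMultiplicative_complexTotient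
  rw [hsum, ← IsMultiplicative.prodPrimeFactors_one_sub_of_squarefree _ hmul hsq,
    totient_div_eq_prod_primeFactors hsq.ne_zero, ← Finset.prod_mul_distrib,
    if_congr (forall_dvd_pow_iff_forall_primeFactors hsq.ne_zero x) rfl rfl]
  trans ∏ p ∈ m.primeFactors, if ¬ ∃ y : G, y ^ p = x then (1 : ℂ) else 0
  swap
  · rw [Finset.prod_ite_zero, Finset.prod_const_one]
  refine Finset.prod_congr rfl fun p hp ↦ ?_
  have hp := Nat.prime_of_mem_primeFactors hp
  have hp0 : (p : ℂ) ≠ 0 := Nat.cast_ne_zero.2 hp.ne_zero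
  have hp1 : (p : ℂ) - 1 ≠ 0 := sub_ne_zero.2 (Nat.cast_ne_one.2 hp.ne_one)
  rw [pdiv_apply, moebius_mul_apply_prime _ hp, (isMultiplicative_powIndicator x).map_one]
  simp only [complexTotient, powIndicator, coe_mk, Nat.totient_prime hp, Nat.cast_pred hp.pos]
  by_cases h : ∃ y : G, y ^ p = x
  · simp [h, hp1]
  · simp only [h, if_false, not_false_eq_true, if_true]
    field_simp
    ring


open ArithmeticFunction in
theorem stmt_13 (G : Type*) [CommGroup G] [Fintype G] [IsCyclic G]
    [Fintype (G →* ℂˣ)] (N m : ℕ) (hN : Fintype.card G = N)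
    (hm : m ∣ N) (hsq : Squarefree m) (x : G) (S : ℂ) :
    (((Nat.totient m : ℂ) / m) *
        ∑ d ∈ m.divisors, ((moebius d : ℂ) / (Nat.totient d : ℂ)) *
          ∑ χ : G →* ℂˣ, (if orderOf χ = d then ((χ x : ℂˣ) : ℂ) else 0))
      = S →
    ((∀ d : ℕ, d ∣ m → (∃ y : G, y ^ d = x) → d = 1) → S = 1) ∧
      (¬ (∀ d : ℕ, d ∣ m → (∃ y : G, y ^ d = x) → d = 1) → S = 0) := by
  classical
  rintro rfl
  subst hN
  rw [totient_div_mul_sum_eq_ite hm hsq x]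
  exact ⟨fun h ↦ if_pos h, fun h ↦ if_neg h⟩
end

section
/- Let q be a prime power, n ≥ 2, r | q^n − 1, and with the notation s, u, f_1, ..., f_k as in the decomposition of r and q^n − 1 (s the part of r supported on primes p with p^{a_p} ∥ q^n−1 and p^{a_p} ∥ r; u the radical of the part of q^n−1 coprime to r; f_i = p_i^{b_i+1} for primes p_i with b_i = v_{p_i}(r) and v_{p_i}(q^n−1) > b_i > 0). If q > (s·f_1⋯f_k·d(u))² · (n−1)², then for every θ generating F_{q^n}/F_q and every α ∈ F_{q^n}^*, there exists x ∈ F_q such that α(θ + x) is r-primitive. -/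
section CharacterSums

open Polynomial Finset

theorem eq_zero_of_sum_mul_eq_zero_of_gaps {E : Type*} [Field E] (a : E) (A M : ℕ)
    (f U : ℕ → E[X]) (N : ℕ → ℕ) (hU : ∀ l, (U l).eval a ≠ 0)
    (hN : ∀ l l', l < l' → l' < M → N l + A ≤ N l')
    (hf : ∀ l, f l ≠ 0 → (f l).natDegree < A)
    (h : ∑ l ∈ range M, f l * ((X - C a) ^ N l * U l) = 0) :
    ∀ l < M, f l = 0 := by
  intro l
  induction l using Nat.strong_induction_on with
  | _ l ih =>
  intro hl
  have hd : (X - C a) ^ (N l + A) ∣ f l * ((X - C a) ^ N l * U l) := by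
    rw [← Finset.add_sum_erase _ _ (mem_range.2 hl)] at h
    rw [eq_neg_of_add_eq_zero_left h, dvd_neg]
    refine Finset.dvd_sum fun l' hl' => ?_
    simp only [mem_erase, mem_range] at hl'
    rcases lt_or_gt_of_ne hl'.1 with h1 | h1
    · simp [ih l' h1 hl'.2]
    · exact ((pow_dvd_pow _ (hN l l' h1 hl'.2)).mul_right _).mul_left _
  have hd2 : (X - C a) ^ A ∣ f l * U l := by
    rw [pow_add, mul_left_comm] at hd
    exact (mul_dvd_mul_iff_left (pow_ne_zero _ (X_sub_C_ne_zero a))).1 hd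
  have hc : IsCoprime ((X - C a) ^ A) (U l) := by
    refine IsCoprime.pow_left ?_
    exact ((irreducible_X_sub_C a).coprime_iff_not_dvd).2 fun hdv => hU l (dvd_iff_isRoot.1 hdv)
  have hd3 := hc.dvd_of_dvd_mul_right hd2
  by_contra hne
  have h1 := natDegree_le_of_dvd hd3 hne
  rw [natDegree_pow, natDegree_X_sub_C, mul_one] at h1
  exact absurd (hf l hne) (not_lt.2 h1)

theorem exists_sum_smul_eq_zero_of_natDegree_lt {E : Type*} [Field E] {ι : Type*} [Fintype ι]
    (v : ι → E[X]) (M : ℕ) (hv : ∀ i, (v i).natDegree < M) (hM : M < Fintype.card ι) :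
    ∃ c : ι → E, ∑ i, C (c i) * v i = 0 ∧ ∃ i, c i ≠ 0 := by
  have hmem : ∀ i, v i ∈ degreeLT E M := fun i =>
    mem_degreeLT.2 (lt_of_le_of_lt degree_le_natDegree (by exact_mod_cast hv i))
  have hfin : Module.finrank E (degreeLT E M) = M := by
    rw [(degreeLTEquiv E M).finrank_eq]; simp
  have : Module.Finite E (degreeLT E M) := Module.Finite.equiv (degreeLTEquiv E M).symm
  have hli : ¬ LinearIndependent E (fun i => (⟨v i, hmem i⟩ : degreeLT E M)) := by
    intro hli
    have := hli.fintype_card_le_finrank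
    omega
  obtain ⟨c, hc, hi⟩ := Fintype.not_linearIndependent_iff.1 hli
  refine ⟨c, ?_, hi⟩
  have := congrArg Subtype.val hc
  simpa [smul_eq_C_mul] using this

theorem stepanov_gap {D c L A : ℕ} (hD : 0 < D) (hLD : L = D * c + 1) (hA : A + D = c + 2)
    {l l' : ℕ} (h : l < l') :
    (l / D) * L + (l % D) * (1 + c) + A ≤ (l' / D) * L + (l' % D) * (1 + c) := by
  have h1 := Nat.div_add_mod l D
  have h2 := Nat.div_add_mod l' D
  have h3 := Nat.mod_lt l hD
  have h4 : l / D ≤ l' / D := Nat.div_le_div_right h.le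
  generalize l / D = j at *
  generalize l' / D = j' at *
  generalize l % D = i at *
  generalize l' % D = i' at *
  rcases h4.eq_or_lt with rfl | h5
  · have : i + 1 ≤ i' := by omega
    have h6 : (i + 1) * (1 + c) ≤ i' * (1 + c) := Nat.mul_le_mul_right _ this
    nlinarith
  · have h6 : (j + 1) * L ≤ j' * L := Nat.mul_le_mul_right _ h5
    have h7 : i * (1 + c) + (1 + c) ≤ D * (1 + c) := by
      have : (i + 1) * (1 + c) ≤ D * (1 + c) := Nat.mul_le_mul_right _ h3
      linarith
    have h8 : i' * (1 + c) ≥ 0 := Nat.zero_le _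
    nlinarith

theorem stepanov_dimension {D c L A δ : ℕ} (hD : 3 ≤ D) (hc : 2 * D ≤ c) (hLD : L = D * c + 1)
    (hA : A + D = c + 2) :
    L * A + (c + (8 * D * δ + 16)) + D * L * δ < D * (c + (8 * D * δ + 16)) * A := by
  subst hLD
  obtain ⟨e, rfl⟩ : ∃ e, c = 2 * D + e := ⟨c - 2 * D, by omega⟩
  obtain rfl : A = D + e + 2 := by omega
  obtain ⟨f, rfl⟩ : ∃ f, D = f + 3 := ⟨D - 3, by omega⟩
  zify
  rw [← sub_pos]
  ring_nf
  positivity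

theorem card_pow_eval_eq_le {E : Type*} [Field E] [Fintype E] [DecidableEq E] (p s : ℕ)
    [Fact p.Prime] [CharP E p] (L D c : ℕ) (hL : L = p ^ s) (hLD : L = D * c + 1)
    (hE : Fintype.card E = L ^ 2) (hD : 3 ≤ D) (hc : 2 * D ≤ c) (a : E) (G₁ : E[X])
    (hG₁ : G₁.eval a ≠ 0) (ζ : E) :
    #{x : E | ((X - C a) * G₁).eval x ^ (c * (L + 1)) = ζ} ≤
      c * L + (8 * D * ((X - C a) * G₁).natDegree +
        2 * ((X - C a) * G₁).natDegree + 19) * L := by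
  set G := (X - C a) * G₁ with hG
  set δ := G.natDegree with hδ
  obtain ⟨A, hA⟩ : ∃ A, A + D = c + 2 := ⟨c + 2 - D, by omega⟩
  set J := c + (8 * D * δ + 16) with hJ
  have hcL : c ≤ L := by nlinarith
  have hDL : D ≤ L := by nlinarith
  let v : Fin (D * J) × Fin A → E[X] := fun i =>
    C (ζ ^ (i.1.1 % D)) * (X ^ (L * i.2.1) * ((X - C a) ^ (i.1.1 / D) *
      G ^ ((i.1.1 % D) * (L - c))))
  have hv : ∀ i, (v i).natDegree < L * A + J + D * L * δ := by
    rintro ⟨l, t⟩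
    have h1 : l.1 % D < D := Nat.mod_lt _ (by omega)
    have h2 : l.1 / D < J := Nat.div_lt_of_lt_mul l.2
    have h3 : (v (l, t)).natDegree ≤ L * t.1 + (l.1 / D + (l.1 % D) * (L - c) * δ) := by
      refine (natDegree_C_mul_le _ _).trans ?_
      refine natDegree_mul_le.trans (add_le_add (natDegree_X_pow_le _) ?_)
      refine natDegree_mul_le.trans (add_le_add ?_ natDegree_pow_le)
      refine natDegree_pow_le.trans ?_
      rw [natDegree_X_sub_C, mul_one]
    have h4 : L * t.1 ≤ L * A := Nat.mul_le_mul_left _ t.2.le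
    have h5 : (l.1 % D) * (L - c) * δ ≤ D * L * δ := by gcongr; omega
    omega
  obtain ⟨b, hb, i₀, hi₀⟩ := exists_sum_smul_eq_zero_of_natDegree_lt v _ hv (by
    rw [Fintype.card_prod, Fintype.card_fin, Fintype.card_fin]
    exact stepanov_dimension hD hc hLD hA)
  have hsurj : Function.Surjective (fun x : E => x ^ L) := by
    have : Function.Injective (fun x : E => x ^ L) := by
      rw [hL]; exact iterateFrobenius_inj E p s
    exact Finite.surjective_of_injective this
  choose ρ hρ using hsurj
  simp only at hρ
  let k : ℕ → E[X] := fun l => if h : l < D * J then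
    ∑ t : Fin A, C (ρ (b (⟨l, h⟩, t))) * X ^ t.1 else 0
  have hk : ∀ l (h : l < D * J), k l = ∑ t : Fin A, C (ρ (b (⟨l, h⟩, t))) * X ^ t.1 := by
    intro l h; simp only [k, dif_pos h]
  have hkd : ∀ l, (k l).degree < A := by
    intro l
    by_cases h : l < D * J
    · rw [hk l h]
      refine mem_degreeLT.1 (Submodule.sum_mem _ fun t _ => mem_degreeLT.2 ?_)
      refine (degree_C_mul_X_pow_le _ _).trans_lt ?_
      exact_mod_cast t.2
    · simp only [k, dif_neg h, degree_zero]; exact WithBot.bot_lt_coe A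
  have hkd' : ∀ l, k l ≠ 0 → (k l).natDegree < A := fun l h =>
    (natDegree_lt_iff_degree_lt h).2 (hkd l)
  let T : E[X] := ∑ l ∈ range (D * J), k l * ((X - C a) ^ ((l / D) * L + (l % D) * (1 + c)) *
    G₁ ^ ((l % D) * (1 + c)))
  have hTG : ∀ l, (X - C a) ^ ((l / D) * L + (l % D) * (1 + c)) * G₁ ^ ((l % D) * (1 + c)) =
      (X - C a) ^ ((l / D) * L) * G ^ ((l % D) * (1 + c)) := by
    intro l; rw [hG, mul_pow, pow_add]; ring
  have hT0 : T ≠ 0 := by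
    intro h0
    have := eq_zero_of_sum_mul_eq_zero_of_gaps a A (D * J) k (fun l => G₁ ^ ((l % D) * (1 + c)))
      (fun l => (l / D) * L + (l % D) * (1 + c)) (fun l => by simpa using fun h => absurd h hG₁)
      (fun l l' h _ => stepanov_gap (by omega) hLD hA h) hkd' h0 i₀.1.1 i₀.1.2
    rw [hk _ i₀.1.2] at this
    have h2 := congrArg (fun f => coeff f i₀.2.1) this
    simp only [finsetSum_coeff, coeff_C_mul, coeff_X_pow, coeff_zero] at h2
    rw [Finset.sum_eq_single i₀.2 (fun t _ ht => by
      rw [if_neg (fun h => ht (Fin.ext h.symm)), mul_zero]) (by simp)] at h2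
    simp only [if_true, mul_one] at h2
    have h3 := hρ (b (⟨i₀.1.1, i₀.1.2⟩, i₀.2))
    rw [h2] at h3
    have hL0 : L ≠ 0 := by omega
    rw [zero_pow hL0] at h3
    exact hi₀ h3.symm
  have hTd : T.natDegree ≤ A + (J * L + D * (1 + c) * δ) := by
    refine natDegree_sum_le_of_forall_le _ _ fun l hl => ?_
    rw [hTG]
    have h1 : l % D < D := Nat.mod_lt _ (by omega)
    have h2 : l / D < J := Nat.div_lt_of_lt_mul (mem_range.1 hl)
    refine natDegree_mul_le.trans (add_le_add ?_ ?_)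
    · exact natDegree_le_of_degree_le (hkd l).le
    · refine natDegree_mul_le.trans (add_le_add ?_ ?_)
      · refine natDegree_pow_le.trans ?_
        rw [natDegree_X_sub_C, mul_one]
        gcongr
      · refine natDegree_pow_le.trans ?_
        gcongr
  have hroot : ∀ x : E, G.eval x ^ (c * (L + 1)) = ζ → T.eval x = 0 := by
    intro x hx
    have hxL : ∀ y : E, (y ^ L) ^ L = y := by
      intro y; rw [← pow_mul, ← sq, ← hE, FiniteField.pow_card]
    have hL0 : L ≠ 0 := by omega
    have key : T.eval x ^ L = 0 := by
      have hb' := congrArg (eval x) hb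
      rw [eval_finsetSum, eval_zero, Fintype.sum_prod_type] at hb'
      have hadd : ∀ (ι : Type) (S : Finset ι) (f : ι → E),
          (∑ i ∈ S, f i) ^ L = ∑ i ∈ S, f i ^ L := by
        intro ι S f; rw [hL]; exact sum_pow_char_pow p s S f
      rw [← hb']
      simp only [T]
      rw [eval_finsetSum, hadd, ← Fin.sum_univ_eq_sum_range (fun l => eval x (k l *
        ((X - C a) ^ ((l / D) * L + (l % D) * (1 + c)) * G₁ ^ ((l % D) * (1 + c)))) ^ L)]
      refine Finset.sum_congr rfl fun l _ => ?_
      rw [hTG, eval_mul, mul_pow, hk l.1 l.2, eval_finsetSum, hadd, Finset.sum_mul]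
      refine Finset.sum_congr rfl fun t _ => ?_
      simp only [v, eval_mul, eval_pow, eval_C, eval_X, eval_sub, mul_pow, hρ]
      have e1 : ((x - a) ^ (l.1 / D * L)) ^ L = (x - a) ^ (l.1 / D) := by
        rw [mul_comm, pow_mul, pow_right_comm, hxL]
      have e2 : (eval x G ^ (l.1 % D * (1 + c))) ^ L =
          ζ ^ (l.1 % D) * eval x G ^ (l.1 % D * (L - c)) := by
        rw [← hx, ← pow_mul, ← pow_mul, ← pow_add]
        congr 1
        obtain ⟨w, hw⟩ := Nat.exists_eq_add_of_le hcL
        have : L - c = w := by omega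
        rw [this]
        nth_rewrite 2 [hw]
        nth_rewrite 1 [hw]
        ring_nf
      rw [e1, e2, ← pow_mul, mul_comm t.1 L]
      ring
    exact pow_eq_zero_iff hL0 |>.1 key
  have hsub : ({x : E | G.eval x ^ (c * (L + 1)) = ζ} : Finset E) ⊆ T.roots.toFinset := by
    intro x hx
    simp only [mem_filter, mem_univ, true_and] at hx
    rw [Multiset.mem_toFinset, mem_roots hT0]
    exact hroot x hx
  have hcard := (card_le_card hsub).trans ((Multiset.toFinset_card_le _).trans
    ((card_roots' T).trans hTd))
  refine hcard.trans ?_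
  have h2L : D * (1 + c) ≤ 2 * L := by nlinarith
  have : D * (1 + c) * δ ≤ 2 * L * δ := Nat.mul_le_mul_right _ h2L
  rw [hJ]
  nlinarith

section MonicSums

variable {F : Type*} [Field F] [Finite F]

theorem finite_monic_natDegree_eq (d : ℕ) : {g : F[X] | g.Monic ∧ g.natDegree = d}.Finite := by
  have : Finite (degreeLT F (d + 1)) := Finite.of_equiv _ (degreeLTEquiv F (d + 1)).symm.toEquiv
  refine (Set.toFinite (degreeLT F (d + 1) : Set F[X])).subset fun g hg => ?_
  rw [SetLike.mem_coe, mem_degreeLT]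
  refine degree_le_natDegree.trans_lt ?_
  rw [hg.2]
  exact_mod_cast Nat.lt_succ_self d

/-- The monic polynomials of degree `d` over a finite field. -/
noncomputable def monicsOfDegree (F : Type*) [Field F] [Finite F] (d : ℕ) : Finset F[X] :=
  (finite_monic_natDegree_eq (F := F) d).toFinset

theorem mem_monicsOfDegree {d : ℕ} {g : F[X]} :
    g ∈ monicsOfDegree F d ↔ g.Monic ∧ g.natDegree = d := by
  simp [monicsOfDegree]

open Classical in
/-- The monic irreducible polynomials over a finite field whose degree is at most `d`. -/
noncomputable def monicIrreducibles (F : Type*) [Field F] [Finite F] (d : ℕ) : Finset F[X] :=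
  ((range (d + 1)).biUnion fun i => monicsOfDegree F i).filter Irreducible

theorem mem_monicIrreducibles {d : ℕ} {g : F[X]} :
    g ∈ monicIrreducibles F d ↔ g.Monic ∧ g.natDegree ≤ d ∧ Irreducible g := by
  simp only [monicIrreducibles, mem_filter, mem_biUnion, mem_range, mem_monicsOfDegree]
  constructor
  · rintro ⟨⟨i, hi, hg, rfl⟩, h⟩; exact ⟨hg, by omega, h⟩
  · rintro ⟨hg, hd, h⟩; exact ⟨⟨_, by omega, hg, rfl⟩, h⟩

/-- The degree `d` coefficient of the `L`-series of a multiplicative function on polynomials. -/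
noncomputable def lCoeff (ψ : F[X] →* ℂ) (d : ℕ) : ℂ := ∑ g ∈ monicsOfDegree F d, ψ g

/-- The coefficients of the logarithmic derivative of the `L`-series of a multiplicative function
on polynomials. -/
noncomputable def lPowerSum (ψ : F[X] →* ℂ) (m : ℕ) : ℂ :=
  ∑ P ∈ (monicIrreducibles F m).filter (fun P => P.natDegree ∣ m),
    (P.natDegree : ℂ) * ψ P ^ (m / P.natDegree)

theorem lCoeff_zero (ψ : F[X] →* ℂ) : lCoeff ψ 0 = 1 := by
  have : monicsOfDegree F 0 = {1} := by
    ext g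
    rw [mem_monicsOfDegree, mem_singleton]
    constructor
    · rintro ⟨h, h'⟩; exact h.natDegree_eq_zero.1 h'
    · rintro rfl; exact ⟨monic_one, natDegree_one⟩
  rw [lCoeff, this, sum_singleton, map_one]

open Classical in
theorem natDegree_eq_sum_pow_dvd {d : ℕ} {g : F[X]} (hg : g ∈ monicsOfDegree F d) :
    d = ∑ P ∈ monicIrreducibles F d, ∑ k ∈ Icc 1 d, if P ^ k ∣ g then P.natDegree else 0 := by
  obtain ⟨hm, rfl⟩ := mem_monicsOfDegree.1 hg
  have hg0 := hm.ne_zero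
  set s := UniqueFactorizationMonoid.normalizedFactors g with hs
  have hmem : ∀ P ∈ s, P.Monic ∧ Irreducible P ∧ P ∣ g := fun P hP =>
    ⟨by
      have h1 := UniqueFactorizationMonoid.normalize_normalized_factor P hP
      have h2 := UniqueFactorizationMonoid.ne_zero_of_mem_normalizedFactors hP
      rw [← h1]; exact monic_normalize h2,
     UniqueFactorizationMonoid.irreducible_of_normalized_factor P hP,
     UniqueFactorizationMonoid.dvd_of_mem_normalizedFactors hP⟩
  have hprod : s.prod = g := by
    rw [UniqueFactorizationMonoid.prod_normalizedFactors_eq hg0, hm.normalize_eq_self]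
  have hdeg : g.natDegree = (s.map natDegree).sum := by
    nth_rewrite 1 [← hprod]
    exact natDegree_multiset_prod _ (UniqueFactorizationMonoid.zero_notMem_normalizedFactors g)
  rw [Finset.sum_multiset_map_count] at hdeg
  have hsub : s.toFinset ⊆ monicIrreducibles F g.natDegree := by
    intro P hP
    have := hmem P (Multiset.mem_toFinset.1 hP)
    exact mem_monicIrreducibles.2 ⟨this.1, natDegree_le_of_dvd this.2.2 hg0, this.2.1⟩
  conv_lhs => rw [hdeg]
  rw [Finset.sum_subset hsub (fun P _ hP => by
    rw [Multiset.count_eq_zero_of_notMem (fun h => hP (Multiset.mem_toFinset.2 h)), zero_smul])]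
  refine Finset.sum_congr rfl fun P hP => ?_
  obtain ⟨hPm, hPd, hPi⟩ := mem_monicIrreducibles.1 hP
  have hcount : ∀ k, P ^ k ∣ g ↔ k ≤ s.count P := by
    intro k
    rw [pow_dvd_iff_le_emultiplicity,
      UniqueFactorizationMonoid.emultiplicity_eq_count_normalizedFactors hPi hg0,
      hPm.normalize_eq_self, Nat.cast_le]
  have hle : s.count P ≤ g.natDegree := by
    have := natDegree_le_of_dvd ((hcount _).2 le_rfl) hg0
    rw [natDegree_pow] at this
    exact (Nat.le_mul_of_pos_right _ hPi.natDegree_pos).trans this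
  rw [← Finset.sum_filter, Finset.sum_const]
  congr 1
  have : (Icc 1 g.natDegree).filter (fun k => P ^ k ∣ g) = Icc 1 (s.count P) := by
    ext k; simp only [mem_filter, mem_Icc, hcount]; omega
  rw [this, Nat.card_Icc, Nat.add_sub_cancel]

open Classical in
theorem sum_monicsOfDegree_dvd (ψ : F[X] →* ℂ) {P : F[X]} (hP : P.Monic) (d k : ℕ)
    (h : k * P.natDegree ≤ d) :
    ∑ g ∈ monicsOfDegree F d, (if P ^ k ∣ g then ψ g else 0) =
      ψ P ^ k * lCoeff ψ (d - k * P.natDegree) := by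
  rw [lCoeff, Finset.mul_sum, ← Finset.sum_filter]
  symm
  refine Finset.sum_bij (fun g _ => P ^ k * g) ?_ ?_ ?_ ?_
  · intro g hg
    obtain ⟨h1, h2⟩ := mem_monicsOfDegree.1 hg
    refine mem_filter.2 ⟨mem_monicsOfDegree.2 ⟨(hP.pow k).mul h1, ?_⟩, dvd_mul_right _ _⟩
    rw [(hP.pow k).natDegree_mul h1, natDegree_pow]; omega
  · intro g _ g' _ hgg
    exact mul_left_cancel₀ (hP.pow k).ne_zero hgg
  · intro g hg
    obtain ⟨hg, c, rfl⟩ := mem_filter.1 hg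
    obtain ⟨h1, h2⟩ := mem_monicsOfDegree.1 hg
    have hc := (hP.pow k).of_mul_monic_left h1
    refine ⟨c, mem_monicsOfDegree.2 ⟨hc, ?_⟩, rfl⟩
    rw [(hP.pow k).natDegree_mul hc, natDegree_pow] at h2; omega
  · intro g _
    rw [map_mul, map_pow]

open Classical in
theorem mul_lCoeff_eq_sum (ψ : F[X] →* ℂ) (d : ℕ) :
    (d : ℂ) * lCoeff ψ d =
      ∑ a ∈ antidiagonal d with a.1 < d, lCoeff ψ a.1 * lPowerSum ψ a.2 := by
  have hL : (d : ℂ) * lCoeff ψ d = ∑ P ∈ monicIrreducibles F d,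
      ∑ k ∈ Icc 1 d with k * P.natDegree ≤ d,
        (P.natDegree : ℂ) * (ψ P ^ k * lCoeff ψ (d - k * P.natDegree)) := by
    have : (d : ℂ) * lCoeff ψ d = ∑ g ∈ monicsOfDegree F d, ∑ P ∈ monicIrreducibles F d,
        ∑ k ∈ Icc 1 d, (P.natDegree : ℂ) * (if P ^ k ∣ g then ψ g else 0) := by
      rw [lCoeff, Finset.mul_sum]
      refine Finset.sum_congr rfl fun g hg => ?_
      have h1 := congrArg (Nat.cast : ℕ → ℂ) (natDegree_eq_sum_pow_dvd hg)
      rw [h1]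
      push_cast
      rw [Finset.sum_mul]
      refine Finset.sum_congr rfl fun P _ => ?_
      rw [Finset.sum_mul]
      refine Finset.sum_congr rfl fun k _ => ?_
      split_ifs <;> simp
    rw [this, Finset.sum_comm]
    refine Finset.sum_congr rfl fun P hP => ?_
    obtain ⟨hPm, hPd, hPi⟩ := mem_monicIrreducibles.1 hP
    rw [Finset.sum_comm, Finset.sum_filter]
    refine Finset.sum_congr rfl fun k _ => ?_
    rw [← Finset.mul_sum]
    split_ifs with h
    · rw [sum_monicsOfDegree_dvd ψ hPm d k h]
    · rw [Finset.sum_eq_zero, mul_zero]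
      intro g hg
      obtain ⟨h1, h2⟩ := mem_monicsOfDegree.1 hg
      rw [if_neg]
      intro hdv
      have := natDegree_le_of_dvd hdv h1.ne_zero
      rw [natDegree_pow] at this
      omega
  have hR : ∑ a ∈ antidiagonal d with a.1 < d, lCoeff ψ a.1 * lPowerSum ψ a.2 =
      ∑ P ∈ monicIrreducibles F d, ∑ a ∈ antidiagonal d with (a.1 < d ∧ P.natDegree ∣ a.2),
        (P.natDegree : ℂ) * (ψ P ^ (a.2 / P.natDegree) * lCoeff ψ a.1) := by
    have : ∀ a ∈ (antidiagonal d).filter (fun a => a.1 < d), lCoeff ψ a.1 * lPowerSum ψ a.2 =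
        ∑ P ∈ monicIrreducibles F d, if P.natDegree ∣ a.2 then
          (P.natDegree : ℂ) * (ψ P ^ (a.2 / P.natDegree) * lCoeff ψ a.1) else 0 := by
      intro a ha
      rw [mem_filter, HasAntidiagonal.mem_antidiagonal] at ha
      rw [lPowerSum, Finset.mul_sum, ← Finset.sum_filter]
      have : (monicIrreducibles F a.2).filter (fun P => P.natDegree ∣ a.2) =
          (monicIrreducibles F d).filter (fun P => P.natDegree ∣ a.2) := by
        ext P
        simp only [mem_filter, mem_monicIrreducibles]
        constructor
        · rintro ⟨⟨h1, h2, h3⟩, h4⟩; exact ⟨⟨h1, by omega, h3⟩, h4⟩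
        · rintro ⟨⟨h1, h2, h3⟩, h4⟩
          exact ⟨⟨h1, Nat.le_of_dvd (by omega) h4, h3⟩, h4⟩
      rw [this]
      exact Finset.sum_congr rfl fun P _ => by ring
    rw [Finset.sum_congr rfl this, Finset.sum_comm]
    refine Finset.sum_congr rfl fun P _ => ?_
    rw [← Finset.sum_filter, Finset.filter_filter]
  rw [hL, hR]
  refine Finset.sum_congr rfl fun P hP => ?_
  obtain ⟨hPm, hPd, hPi⟩ := mem_monicIrreducibles.1 hP
  have hpos := hPi.natDegree_pos
  refine Finset.sum_nbij' (fun k => (d - k * P.natDegree, k * P.natDegree))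
    (fun a => a.2 / P.natDegree) ?_ ?_ ?_ ?_ ?_
  · intro k hk
    simp only [mem_filter, mem_Icc, HasAntidiagonal.mem_antidiagonal] at hk ⊢
    have : 0 < k * P.natDegree := Nat.mul_pos (by omega) hpos
    exact ⟨by omega, by omega, dvd_mul_left _ _⟩
  · rintro ⟨a, b⟩ h
    simp only [mem_filter, mem_Icc, HasAntidiagonal.mem_antidiagonal] at h ⊢
    obtain ⟨h1, h2, e, rfl⟩ := h
    rw [Nat.mul_div_cancel_left _ hpos, mul_comm e]
    have he : 0 < e := by
      rcases Nat.eq_zero_or_pos e with rfl | h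
      · omega
      · exact h
    have : e ≤ P.natDegree * e := Nat.le_mul_of_pos_left _ hpos
    exact ⟨⟨he, by omega⟩, by omega⟩
  · intro k _
    exact Nat.mul_div_cancel _ hpos
  · rintro ⟨a, b⟩ h
    simp only [mem_filter, HasAntidiagonal.mem_antidiagonal] at h ⊢
    obtain ⟨h1, h2, h3⟩ := h
    rw [Nat.div_mul_cancel h3]
    ext <;> simp; omega
  · intro k _
    simp only
    rw [Nat.mul_div_cancel _ hpos]

end MonicSums

section LFunction

theorem exists_eq_neg_sum_pow_of_newton (l S : ℕ → ℂ) (N : ℕ) (h0 : l 0 = 1)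
    (hN : ∀ d, N < d → l d = 0)
    (hl : ∀ d : ℕ, (d : ℂ) * l d = ∑ a ∈ antidiagonal d with a.1 < d, l a.1 * S a.2) :
    ∃ ω : Fin N → ℂ, ∀ m, 0 < m → S m = -∑ i, ω i ^ m := by
  let M : ℂ[X] := ∑ d ∈ range (N + 1), C (l d) * X ^ (N - d)
  have hcoeff : ∀ d ≤ N, M.coeff (N - d) = l d := by
    intro d hd
    simp only [M, finsetSum_coeff, coeff_C_mul, coeff_X_pow]
    rw [Finset.sum_eq_single d]
    · simp
    · intro b hb hbd
      rw [if_neg, mul_zero]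
      have := mem_range.1 hb
      omega
    · intro h; exact absurd (mem_range.2 (by omega)) h
  have hdle : M.natDegree ≤ N := natDegree_sum_le_of_forall_le _ _ fun d _ =>
    (natDegree_C_mul_X_pow_le _ _).trans (Nat.sub_le _ _)
  have hMN : M.coeff N = 1 := by simpa [h0] using hcoeff 0 (Nat.zero_le _)
  have hdeg : M.natDegree = N :=
    le_antisymm hdle (le_natDegree_of_ne_zero (by rw [hMN]; exact one_ne_zero))
  have hlead : M.leadingCoeff = 1 := by rw [leadingCoeff, hdeg, hMN]
  have hcard : M.roots.card = M.natDegree :=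
    (IsAlgClosed.splits M).natDegree_eq_card_roots.symm
  obtain ⟨ω, hω⟩ : ∃ ω : Fin N → ℂ, M.roots = univ.val.map ω := by
    have hlen : M.roots.toList.length = N := by rw [Multiset.length_toList, hcard, hdeg]
    refine ⟨fun i => M.roots.toList.get (i.cast hlen.symm), ?_⟩
    rw [Fin.univ_val_map]
    nth_rewrite 1 [← Multiset.coe_toList M.roots]
    congr 1
    refine List.ext_get (by simp [hlen]) ?_
    intro n h1 h2
    simp
  have hesymm : ∀ d, l d = (-1) ^ d * MvPolynomial.aeval ω (MvPolynomial.esymm (Fin N) ℂ d) := by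
    intro d
    rw [MvPolynomial.aeval_esymm_eq_multiset_esymm, ← hω]
    rcases le_or_gt d N with hd | hd
    · rw [← hcoeff d hd, coeff_eq_esymm_roots_of_card hcard (by omega), hlead, hdeg, one_mul]
      congr 2 <;> omega
    · rw [hN d hd, Multiset.esymm, Multiset.powersetCard_eq_empty _ (by omega)]
      simp
  refine ⟨ω, fun m => ?_⟩
  induction m using Nat.strong_induction_on with
  | _ m ih =>
  intro hm
  have h1 := congrArg (MvPolynomial.aeval ω) (MvPolynomial.mul_esymm_eq_sum (Fin N) ℂ m)
  rw [map_mul, map_mul, map_sum, map_natCast] at h1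
  have h2 : (m : ℂ) * l m = -∑ a ∈ antidiagonal m with a.1 < m, l a.1 * ∑ i, ω i ^ a.2 := by
    rw [hesymm m, mul_left_comm, h1, map_pow, map_neg, map_one, pow_succ, ← mul_assoc, ← mul_assoc,
      ← pow_add, Even.neg_one_pow ⟨m, rfl⟩, one_mul, neg_one_mul]
    congr 1
    refine Finset.sum_congr rfl fun a _ => ?_
    rw [hesymm a.1, map_mul, map_mul, map_pow, map_neg, map_one, MvPolynomial.psum, map_sum]
    simp
  rw [hl m, ← sub_eq_zero, sub_neg_eq_add, ← Finset.sum_add_distrib] at h2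
  rw [Finset.sum_eq_single (0, m)] at h2
  · rw [h0, one_mul, one_mul] at h2
    exact eq_neg_of_add_eq_zero_left h2
  · rintro ⟨a, b⟩ hab hne
    simp only [mem_filter, HasAntidiagonal.mem_antidiagonal] at hab
    have ha : a ≠ 0 := by
      rintro rfl
      exact hne (by ext <;> simp; omega)
    simp only
    rw [ih b (by omega) (by omega)]
    ring
  · intro h
    exact absurd (mem_filter.2 ⟨HasAntidiagonal.mem_antidiagonal.2 (by simp), by simpa using hm⟩) h

open Filter Topology in
theorem tendsto_average_pow {w : ℂ} (hw : ‖w‖ ≤ 1) :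
    Tendsto (fun n : ℕ => (n⁻¹ : ℝ) • ∑ k ∈ range n, w ^ k) atTop (𝓝 (if w = 1 then 1 else 0)) := by
  split_ifs with h
  · subst h
    refine tendsto_const_nhds.congr' ?_
    filter_upwards [eventually_gt_atTop 0] with n hn
    have : (n : ℂ) ≠ 0 := by exact_mod_cast hn.ne'
    simp [this]
  · refine squeeze_zero_norm (a := fun n : ℕ => (n⁻¹ : ℝ) * (2 / ‖w - 1‖)) ?_ ?_
    · intro n
      rw [geom_sum_eq h, norm_smul, norm_inv, Real.norm_natCast, norm_div]
      gcongr
      refine (norm_sub_le _ _).trans ?_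
      rw [norm_pow, norm_one]
      linarith [pow_le_one₀ (n := n) (norm_nonneg w) hw]
    · simpa using (tendsto_inv_atTop_nhds_zero_nat (𝕜 := ℝ)).mul_const (2 / ‖w - 1‖)

open Filter Topology in
theorem norm_le_of_norm_sum_pow_le {ι : Type*} [Fintype ι] (z : ι → ℂ) {R B : ℝ}
    (hR : 0 ≤ R) (h : ∀ᶠ k : ℕ in atTop, ‖∑ i, z i ^ k‖ ≤ B * R ^ k) (i : ι) : ‖z i‖ ≤ R := by
  classical
  obtain ⟨j, -, hj⟩ := Finset.exists_max_image univ (fun i => ‖z i‖) ⟨i, mem_univ i⟩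
  refine (hj i (mem_univ i)).trans ?_
  by_contra! hlt
  have hpos : 0 < ‖z j‖ := hR.trans_lt hlt
  have hz : z j ≠ 0 := norm_pos_iff.1 hpos
  have hw : ∀ i, ‖z i / z j‖ ≤ 1 := fun i => by
    rw [norm_div, div_le_one hpos]; exact hj i (mem_univ i)
  have h1 : Tendsto (fun k : ℕ => ∑ i, (z i / z j) ^ k) atTop (𝓝 0) := by
    have hb : Tendsto (fun k : ℕ => B * (R / ‖z j‖) ^ k) atTop (𝓝 0) := by
      simpa using (tendsto_pow_atTop_nhds_zero_of_lt_one (div_nonneg hR hpos.le)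
        ((div_lt_one hpos).2 hlt)).const_mul B
    refine squeeze_zero_norm' ?_ hb
    filter_upwards [h] with k hk
    simp_rw [div_pow]
    rw [← Finset.sum_div, norm_div, norm_pow, ← mul_div_assoc]
    gcongr
  have h2 := h1.cesaro_smul
  have h3 : Tendsto (fun n : ℕ => (n⁻¹ : ℝ) • ∑ k ∈ range n, ∑ i, (z i / z j) ^ k) atTop
      (𝓝 (∑ i, if z i / z j = 1 then 1 else 0)) := by
    have : ∀ n : ℕ, (n⁻¹ : ℝ) • ∑ k ∈ range n, ∑ i, (z i / z j) ^ k =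
        ∑ i, (n⁻¹ : ℝ) • ∑ k ∈ range n, (z i / z j) ^ k := by
      intro n; rw [Finset.sum_comm, Finset.smul_sum]
    simp_rw [this]
    exact tendsto_finsetSum _ fun i _ => tendsto_average_pow (hw i)
  have h4 := tendsto_nhds_unique h2 h3
  rw [Finset.sum_boole] at h4
  have h5 : j ∈ univ.filter (fun i => z i / z j = 1) :=
    mem_filter.2 ⟨mem_univ j, div_self hz⟩
  rw [eq_comm, Nat.cast_eq_zero, card_eq_zero] at h4
  rw [h4] at h5
  exact notMem_empty _ h5

variable {F K : Type*} [Field F] [Finite F] [Field K] [Fintype K] [Algebra F K]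

/-- The multiplicative function on polynomials obtained by evaluating at `θ` and applying a
multiplicative character. -/
noncomputable def MulChar.compAeval (χ : MulChar K ℂ) (θ : K) : F[X] →* ℂ :=
  χ.toMonoidHom.comp (aeval θ : F[X] →ₐ[F] K).toRingHom.toMonoidHom

omit [Finite F] [Fintype K] in
theorem MulChar.compAeval_apply (χ : MulChar K ℂ) (θ : K) (g : F[X]) :
    χ.compAeval θ g = χ (aeval θ g) := rfl

theorem lCoeff_compAeval_eq_zero {χ : MulChar K ℂ} (hχ : χ ≠ 1) {θ : K}
    (hθ : Algebra.adjoin F {θ} = ⊤) {d : ℕ} (hd : Module.finrank F K ≤ d) :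
    lCoeff (F := F) (χ.compAeval θ) d = 0 := by
  have hint : IsIntegral F θ := IsIntegral.of_finite F θ
  have hsurj : ∀ y : K, ∃ p : F[X], p.degree < d ∧ aeval θ p = y := by
    intro y
    have hy : y ∈ Algebra.adjoin F {θ} := hθ ▸ Algebra.mem_top
    rw [Algebra.adjoin_singleton_eq_range_aeval] at hy
    obtain ⟨p, hp⟩ := hy
    refine ⟨p %ₘ minpoly F θ, ?_, ?_⟩
    · refine (degree_modByMonic_lt _ (minpoly.monic hint)).trans_le ?_
      refine degree_le_natDegree.trans ?_
      exact_mod_cast (minpoly.natDegree_le θ).trans hd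
    · rw [← hp]; exact minpoly.aeval_modByMonic_minpoly p θ
  choose p hpd hp using hsurj
  have hshift : ∀ y : K, lCoeff (F := F) (χ.compAeval θ) d =
      ∑ g ∈ monicsOfDegree F d, χ (aeval θ g + y) := by
    intro y
    have hmem : ∀ (g r : F[X]), g ∈ monicsOfDegree F d → r.degree < d →
        g + r ∈ monicsOfDegree F d := by
      intro g r hg hr
      obtain ⟨h1, h2⟩ := mem_monicsOfDegree.1 hg
      have h3 : r.degree < g.degree := by rwa [degree_eq_natDegree h1.ne_zero, h2]
      refine mem_monicsOfDegree.2 ⟨h1.add_of_left h3, ?_⟩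
      rw [natDegree_add_eq_left_of_degree_lt h3, h2]
    symm
    refine Finset.sum_nbij' (fun g => g + p y) (fun g => g + -p y) (fun g hg => hmem g _ hg (hpd y))
      (fun g hg => hmem g _ hg (by rw [degree_neg]; exact hpd y)) (by simp) (by simp) ?_
    intro g _
    rw [MulChar.compAeval_apply, map_add (aeval θ), hp]
  have h1 : (Fintype.card K : ℂ) * lCoeff (F := F) (χ.compAeval θ) d = 0 := by
    have : ∑ y : K, lCoeff (F := F) (χ.compAeval θ) d = 0 := by
      rw [Finset.sum_congr rfl fun y _ => hshift y, Finset.sum_comm]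
      refine Finset.sum_eq_zero fun g _ => ?_
      rw [← MulChar.sum_eq_zero_of_ne_one hχ]
      exact Equiv.sum_comp (Equiv.addLeft (aeval θ g)) (fun y => χ y)
    simpa using this
  exact (mul_eq_zero.1 h1).resolve_left (Nat.cast_ne_zero.2 Fintype.card_ne_zero)

end LFunction

theorem pow_card_pow_injective {F E : Type*} [Field F] [Fintype F] [Field E] [Algebra F E]
    (j : ℕ) : Function.Injective (fun x : E => x ^ Fintype.card F ^ j) := by
  have h1 : Function.Injective (fun x : E => x ^ Fintype.card F) := by
    rw [← FiniteField.coe_frobeniusAlgHom F E]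
    exact (FiniteField.frobeniusAlgHom F E).injective
  induction j with
  | zero => intro x x' h; simpa using h
  | succ j ih =>
    intro x x' hxx
    simp only [pow_succ, pow_mul] at hxx
    exact ih (h1 hxx)

section Extension

variable {F E : Type*} [Field F] [Fintype F] [Field E] [Fintype E] [Algebra F E]

theorem card_filter_minpoly_eq [DecidableEq F[X]] {P : F[X]} (hP : P.Monic) (hi : Irreducible P)
    (hd : P.natDegree ∣ Module.finrank F E) :
    #{x : E | minpoly F x = P} = P.natDegree := by
  classical
  have hsplit : (P.map (algebraMap F E)).Splits := by
    have h1 := map_dvd (mapRingHom (algebraMap F E))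
      (hi.natDegree_dvd_iff_dvd_X_pow_card_pow_sub_X.1 hd)
    simp only [coe_mapRingHom, Polynomial.map_sub, Polynomial.map_pow, map_X] at h1
    rw [← Module.natCard_eq_pow_finrank, Nat.card_eq_fintype_card] at h1
    refine Splits.of_dvd ?_ (FiniteField.X_pow_card_sub_X_ne_zero E Fintype.one_lt_card) h1
    rw [splits_iff_card_roots, FiniteField.roots_X_pow_card_sub_X,
      FiniteField.X_pow_card_sub_X_natDegree_eq E Fintype.one_lt_card]
    rfl
  have h2 := card_rootSet_eq_natDegree (K := E) (PerfectField.separable_of_irreducible hi) hsplit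
  rw [← h2, Fintype.card_subtype]
  congr 1
  ext x
  simp only [mem_filter, mem_univ, true_and]
  rw [mem_rootSet]
  constructor
  · rintro rfl; exact ⟨hi.ne_zero, minpoly.aeval F x⟩
  · rintro ⟨-, h⟩; exact (minpoly.eq_of_irreducible_of_monic hi h hP).symm

theorem lPowerSum_finrank (ψ : F[X] →* ℂ) :
    lPowerSum ψ (Module.finrank F E) =
      ∑ x : E, ψ (minpoly F x) ^ (Module.finrank F E / (minpoly F x).natDegree) := by
  classical
  have hmaps : ∀ x ∈ (univ : Finset E), minpoly F x ∈
      (monicIrreducibles F (Module.finrank F E)).filter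
        (fun P => P.natDegree ∣ Module.finrank F E) := by
    intro x _
    have hx : IsIntegral F x := IsIntegral.of_finite F x
    exact mem_filter.2 ⟨mem_monicIrreducibles.2 ⟨minpoly.monic hx, minpoly.natDegree_le x,
      minpoly.irreducible hx⟩, minpoly.degree_dvd hx⟩
  rw [lPowerSum, ← Finset.sum_fiberwise_of_maps_to hmaps]
  refine Finset.sum_congr rfl fun P hP => ?_
  obtain ⟨hP, hd⟩ := mem_filter.1 hP
  obtain ⟨hm, -, hi⟩ := mem_monicIrreducibles.1 hP
  rw [Finset.sum_congr rfl (g := fun _ => ψ P ^ (Module.finrank F E / P.natDegree))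
    (fun x hx => by rw [(mem_filter.1 hx).2]), Finset.sum_const, card_filter_minpoly_eq hm hi hd,
    nsmul_eq_mul]

theorem pow_card_pow_eq_self_iff_natDegree_minpoly_dvd (x : E) (j : ℕ) :
    x ^ Fintype.card F ^ j = x ↔ (minpoly F x).natDegree ∣ j := by
  have hx : IsIntegral F x := IsIntegral.of_finite F x
  rw [(minpoly.irreducible hx).natDegree_dvd_iff_dvd_X_pow_card_pow_sub_X,
    minpoly.dvd_iff, map_sub, map_pow, aeval_X, sub_eq_zero, Nat.card_eq_fintype_card]

theorem aeval_minpoly_eq_prod (x y : E) :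
    aeval y (minpoly F x) = ∏ i ∈ range (minpoly F x).natDegree, (y - x ^ Fintype.card F ^ i) := by
  classical
  have hx : IsIntegral F x := IsIntegral.of_finite F x
  set q := Fintype.card F
  set d := (minpoly F x).natDegree with hd
  have hinj : Set.InjOn (fun i => x ^ q ^ i) (range d : Set ℕ) := by
    have key : ∀ i j, i < j → j < d → x ^ q ^ i ≠ x ^ q ^ j := by
      intro i j hij hj h
      obtain ⟨e, rfl⟩ := Nat.exists_eq_add_of_lt hij
      have h1 : x ^ q ^ (e + 1) = x := by
        refine pow_card_pow_injective (F := F) i ?_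
        change (x ^ q ^ (e + 1)) ^ q ^ i = x ^ q ^ i
        rw [h, ← pow_mul, ← pow_add]
        congr 2; omega
      have := Nat.le_of_dvd (by omega) ((pow_card_pow_eq_self_iff_natDegree_minpoly_dvd x _).1 h1)
      omega
    intro i hi j hj hij
    simp only [coe_range, Set.mem_Iio] at hi hj
    rcases lt_trichotomy i j with h | h | h
    · exact absurd hij (key i j h hj)
    · exact h
    · exact absurd hij.symm (key j i h hi)
  set p := (minpoly F x).map (algebraMap F E) with hp
  have hpm : p.Monic := (minpoly.monic hx).map _
  have hroots : (range d).image (fun i => x ^ q ^ i) ⊆ p.roots.toFinset := by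
    intro z hz
    obtain ⟨i, -, rfl⟩ := Finset.mem_image.1 hz
    rw [Multiset.mem_toFinset, mem_roots hpm.ne_zero, IsRoot, hp, eval_map_algebraMap]
    have := aeval_algHom_apply (FiniteField.frobeniusAlgHom F E ^ i) x (minpoly F x)
    rw [minpoly.aeval, map_zero] at this
    simpa [FiniteField.coe_frobeniusAlgHom, AlgHom.coe_pow, pow_iterate] using this
  have hdvd : ∏ z ∈ (range d).image (fun i => x ^ q ^ i), (X - C z) ∣ p := by
    refine (Multiset.prod_dvd_prod_of_le (Multiset.map_le_map ?_)).trans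
      (prod_multiset_X_sub_C_dvd p)
    refine (Finset.val_le_iff.2 hroots).trans ?_
    rw [Multiset.toFinset_val]
    exact Multiset.dedup_le _
  have hmon : (∏ z ∈ (range d).image (fun i => x ^ q ^ i), (X - C z)).Monic :=
    monic_prod_of_monic _ _ fun z _ => monic_X_sub_C z
  have heq := eq_of_monic_of_dvd_of_natDegree_le hmon hpm hdvd (by
    rw [natDegree_prod_of_monic _ _ (fun z _ => monic_X_sub_C z)]
    simp only [natDegree_X_sub_C, sum_const, smul_eq_mul, mul_one]
    rw [card_image_of_injOn hinj, card_range, hp, natDegree_map])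
  rw [← eval_map_algebraMap, ← hp, heq, prod_image hinj, eval_prod]
  simp

theorem aeval_minpoly_pow_eq_prod (x y : E) {m : ℕ} (hm : (minpoly F x).natDegree ∣ m) :
    aeval y (minpoly F x) ^ (m / (minpoly F x).natDegree) =
      ∏ i ∈ range m, (y - x ^ Fintype.card F ^ i) := by
  obtain ⟨e, rfl⟩ := hm
  have hx : IsIntegral F x := IsIntegral.of_finite F x
  rw [Nat.mul_div_cancel_left _ (minpoly.natDegree_pos hx)]
  induction e with
  | zero => simp
  | succ e ih =>
    rw [pow_succ, ih, Nat.mul_succ, prod_range_add, aeval_minpoly_eq_prod]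
    congr 1
    refine Finset.prod_congr rfl fun i _ => ?_
    rw [pow_add, pow_mul,
      (pow_card_pow_eq_self_iff_natDegree_minpoly_dvd x _).2 (dvd_mul_right _ _)]

end Extension

theorem sub_pow_card_pow {F E : Type*} [Field F] [Fintype F] [CommRing E] [Algebra F E]
    (a b : E) (j : ℕ) :
    (a - b) ^ Fintype.card F ^ j = a ^ Fintype.card F ^ j - b ^ Fintype.card F ^ j := by
  have h := map_sub (FiniteField.frobeniusAlgHom F E ^ j) a b
  simpa [FiniteField.coe_frobeniusAlgHom, AlgHom.coe_pow, pow_iterate] using h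

theorem norm_mulChar_le_one {K : Type*} [Field K] [Finite K] (χ : MulChar K ℂ) (x : K) :
    ‖χ x‖ ≤ 1 := by
  have := Fintype.ofFinite K
  by_cases hx : x = 0
  · simp [hx, χ.map_zero]
  · have h : χ x ^ (Fintype.card K - 1) = 1 := by
      rw [← map_pow, FiniteField.pow_card_sub_one_eq_one x hx, map_one]
    exact (Complex.norm_eq_one_of_pow_eq_one h
      (Nat.sub_ne_zero_of_lt Fintype.one_lt_card)).le

/-- If no fibre of `v` exceeds `B`, and the zero fibre has at most `δ` elements, then the values
of `v` are nearly equidistributed with respect to any nontrivial character. -/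
theorem norm_sum_mulChar_comp_le {X K : Type*} [Fintype X] [Field K] [Fintype K] [DecidableEq K]
    {χ : MulChar K ℂ} (hχ : χ ≠ 1) (v : X → K) (B δ : ℕ) (hv : ∀ ζ, #{x | v x = ζ} ≤ B)
    (h0 : #{x | v x = 0} ≤ δ) :
    ‖∑ x, χ (v x)‖ ≤ ((Fintype.card K : ℝ) - 1) * B - (Fintype.card X - δ) := by
  have h1 : ∑ x, χ (v x) = ∑ ζ, (#{x | v x = ζ} : ℂ) * χ ζ := by
    rw [← Finset.sum_fiberwise univ v]
    refine Finset.sum_congr rfl fun ζ _ => ?_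
    rw [Finset.sum_congr rfl (g := fun _ => χ ζ)
      (fun x hx => by rw [(mem_filter.1 hx).2]), Finset.sum_const, nsmul_eq_mul]
  have h2 : ∑ x, χ (v x) = -∑ ζ ∈ univ.erase 0, ((B : ℂ) - #{x | v x = ζ}) * χ ζ := by
    have h3 : ∑ ζ, ((B : ℂ) - #{x | v x = ζ}) * χ ζ = -∑ x, χ (v x) := by
      simp_rw [sub_mul]
      rw [Finset.sum_sub_distrib, ← Finset.mul_sum, MulChar.sum_eq_zero_of_ne_one hχ, h1]
      simp
    rw [← neg_eq_iff_eq_neg, ← h3, ← Finset.add_sum_erase _ _ (mem_univ (0 : K)), χ.map_zero]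
    simp
  have h4 : ∑ ζ : K, (#{x | v x = ζ} : ℝ) = Fintype.card X := by
    rw [← Nat.cast_sum, ← Finset.card_eq_sum_card_fiberwise (fun x _ => mem_univ (v x))]
    rfl
  rw [← Finset.add_sum_erase _ _ (mem_univ (0 : K))] at h4
  have h5 : (#{x | v x = 0} : ℝ) ≤ δ := by exact_mod_cast h0
  rw [h2, norm_neg]
  calc _ ≤ ∑ ζ ∈ univ.erase (0 : K), ((B : ℝ) - #{x | v x = ζ}) := by
        refine norm_sum_le_of_le _ fun ζ _ => ?_
        have h6 : (#{x | v x = ζ} : ℝ) ≤ B := by exact_mod_cast hv ζ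
        have h7 : ‖(B : ℂ) - #{x | v x = ζ}‖ = (B : ℝ) - #{x | v x = ζ} := by
          rw [← Complex.ofReal_natCast, ← Complex.ofReal_natCast, ← Complex.ofReal_sub,
            Complex.norm_real, Real.norm_of_nonneg (by linarith)]
        rw [norm_mul, h7]
        exact mul_le_of_le_one_right (by linarith) (norm_mulChar_le_one χ ζ)
    _ ≤ _ := by
        rw [Finset.sum_sub_distrib, Finset.sum_const, Finset.card_erase_of_mem (mem_univ _),
          Finset.card_univ, nsmul_eq_mul, Nat.cast_sub Fintype.card_pos]
        push_cast
        linarith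

section ConjugateProd

variable {F E : Type*} [Fintype F] [Field E]

variable (F) in
/-- For `y` in the extension of degree `n` of `F`, with conjugates `y ^ q ^ (n - i)`, this is
`∏ i, (X - y ^ q ^ (n - i)) ^ q ^ i`; its value at `x` is `∏ i < n, (x ^ q ^ i - y)`. -/
noncomputable def conjugateProd (n : ℕ) (y : E) : E[X] :=
  ∏ i ∈ range n, (X - C (y ^ Fintype.card F ^ (n - i))) ^ Fintype.card F ^ i

theorem natDegree_conjugateProd (n : ℕ) (y : E) :
    (conjugateProd F n y).natDegree = ∑ i ∈ range n, Fintype.card F ^ i := by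
  rw [conjugateProd, natDegree_prod_of_monic _ _ fun _ _ => (monic_X_sub_C _).pow _]
  simp only [natDegree_pow, natDegree_X_sub_C, mul_one]

theorem conjugateProd_ne_zero (n : ℕ) (y : E) : conjugateProd F n y ≠ 0 :=
  (monic_prod_of_monic _ _ fun _ _ => (monic_X_sub_C _).pow _).ne_zero

variable [Field F]

theorem exists_conjugateProd_eq_mul {n : ℕ} {y : E} (hn : 0 < n)
    (hy : ∀ j, y ^ Fintype.card F ^ j = y ↔ n ∣ j) :
    ∃ G : E[X], G.eval y ≠ 0 ∧ conjugateProd F n y = (X - C y) * G := by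
  obtain ⟨n, rfl⟩ := Nat.exists_eq_add_of_lt hn
  rw [zero_add] at hy ⊢
  refine ⟨∏ i ∈ range n, (X - C (y ^ Fintype.card F ^ (n + 1 - (i + 1)))) ^
    Fintype.card F ^ (i + 1), ?_, ?_⟩
  · rw [eval_prod, Finset.prod_ne_zero_iff]
    intro i hi h
    rw [mem_range] at hi
    rw [eval_pow, eval_sub, eval_X, eval_C, pow_eq_zero_iff (by positivity), sub_eq_zero] at h
    have := Nat.le_of_dvd (by omega) ((hy _).1 h.symm)
    omega
  · rw [conjugateProd, Finset.prod_range_succ']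
    simp only [pow_zero, pow_one, Nat.sub_zero, (hy (n + 1)).2 dvd_rfl]
    ring

variable [Algebra F E]

theorem eval_conjugateProd {n : ℕ} {y : E} (hy : y ^ Fintype.card F ^ n = y) (x : E) :
    (conjugateProd F n y).eval x = ∏ i ∈ range n, (x ^ Fintype.card F ^ i - y) := by
  rw [conjugateProd, eval_prod]
  refine Finset.prod_congr rfl fun i hi => ?_
  rw [mem_range] at hi
  rw [eval_pow, eval_sub, eval_X, eval_C, sub_pow_card_pow, ← pow_mul, ← pow_add,
    Nat.sub_add_cancel hi.le, hy]

theorem eval_conjugateProd_pow {n : ℕ} {y : E} (hy : y ^ Fintype.card F ^ n = y) (x : E)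
    (M : ℕ) :
    (conjugateProd F n y).eval x ^ (∑ l ∈ range M, (Fintype.card F ^ n) ^ l) =
      ∏ j ∈ range (n * M), (x ^ Fintype.card F ^ j - y) := by
  have hy' : ∀ l, y ^ Fintype.card F ^ (n * l) = y := by
    intro l
    induction l with
    | zero => simp
    | succ l ih => rw [Nat.mul_succ, pow_add, pow_mul, ih, hy]
  induction M with
  | zero => simp
  | succ M ih =>
    rw [Finset.sum_range_succ, pow_add, ih, Nat.mul_succ, prod_range_add,
      eval_conjugateProd hy, ← Finset.prod_pow]
    congr 1
    refine Finset.prod_congr rfl fun i _ => ?_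
    rw [← pow_mul (Fintype.card F), sub_pow_card_pow, hy', ← pow_mul x, ← pow_add, add_comm i]

end ConjugateProd

theorem natDegree_minpoly_eq_finrank_of_adjoin_eq_top {F K : Type*} [Field F] [Field K]
    [Algebra F K] [FiniteDimensional F K] {θ : K} (hθ : Algebra.adjoin F {θ} = ⊤) :
    (minpoly F θ).natDegree = Module.finrank F K := by
  have hi : IsIntegral F θ := IsIntegral.of_finite F θ
  have h : IntermediateField.adjoin F {θ} = ⊤ := by
    rw [← IntermediateField.toSubalgebra_inj,
      IntermediateField.adjoin_simple_toSubalgebra_of_isAlgebraic hi.isAlgebraic, hθ]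
    rfl
  exact (Field.primitive_element_iff_minpoly_natDegree_eq F θ).1 h

section Tower

variable {F K E : Type*} [Field F] [Fintype F] [Field K] [Fintype K] [Field E] [Fintype E]
  [Algebra F K] [Algebra K E] [Algebra F E] [IsScalarTower F K E]

theorem norm_lPowerSum_compAeval_tower_le {θ : K} (hθ : Algebra.adjoin F {θ} = ⊤)
    {χ : MulChar K ℂ} (hχ : χ ≠ 1) (hn : 2 ≤ Module.finrank F K) {k : ℕ} (hk : 4 ≤ k)
    (hE : Module.finrank K E = 2 * k) (δ : ℕ)
    (hδ : δ = ∑ i ∈ range (Module.finrank F K), Fintype.card F ^ i) :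
    ‖lPowerSum (MulChar.compAeval (F := F) χ θ) (Module.finrank F K * (2 * k))‖ ≤
      ((Fintype.card K : ℝ) * (8 * Fintype.card K * δ + 2 * δ + 19) + δ) *
        Fintype.card K ^ k := by
  classical
  set n := Module.finrank F K with hn'
  set q := Fintype.card F with hq
  have hq2 : 2 ≤ q := Fintype.one_lt_card
  have hKq : Fintype.card K = q ^ n := Module.card_eq_pow_finrank
  have hFE : Module.finrank F E = n * (2 * k) := by
    rw [← hE, hn', Module.finrank_mul_finrank]
  set Q := Fintype.card K with hQ
  have hQ4 : 4 ≤ Q := by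
    rw [hKq]; calc 4 = 2 ^ 2 := rfl
      _ ≤ q ^ 2 := Nat.pow_le_pow_left hq2 2
      _ ≤ q ^ n := Nat.pow_le_pow_right (by omega) hn
  have hEQ : Fintype.card E = (Q ^ k) ^ 2 := by
    rw [Module.card_eq_pow_finrank (K := K), hE, ← pow_mul, mul_comm]
  obtain ⟨p, hpc⟩ := CharP.exists F
  obtain ⟨a, hp, hFa⟩ := FiniteField.card F p
  have : Fact p.Prime := ⟨hp⟩
  have : CharP E p := charP_of_injective_algebraMap (algebraMap F E).injective p
  set c := ∑ l ∈ range k, Q ^ l with hc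
  have hcQ : Q ^ k = (Q - 1) * c + 1 := by
    have := Nat.geomSum_eq (m := Q) (by omega) k
    rw [← hc] at this
    have hdiv : (Q - 1) ∣ Q ^ k - 1 := by simpa using Nat.sub_dvd_pow_sub_pow Q 1 k
    have h1 : 1 ≤ Q ^ k := Nat.one_le_pow _ _ (by omega)
    rw [this, Nat.mul_div_cancel' hdiv]
    omega
  have hc2 : c * (Q ^ k + 1) = ∑ l ∈ range (2 * k), Q ^ l := by
    rw [two_mul, Finset.sum_range_add, mul_add, mul_one, add_comm, hc, Finset.sum_mul]
    congr 1
    exact Finset.sum_congr rfl fun i _ => by ring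
  have hc3 : 2 * (Q - 1) ≤ c := by
    have : ∑ l ∈ range 3, Q ^ l ≤ c :=
      Finset.sum_le_sum_of_subset (range_subset_range.2 (by omega))
    simp only [Finset.sum_range_succ, Finset.sum_range_zero] at this
    nlinarith [Nat.sub_le Q 1]
  set y := algebraMap K E θ with hy
  have hmin : minpoly F y = minpoly F θ :=
    minpoly.algebraMap_eq (algebraMap K E).injective θ
  have hyj : ∀ j, y ^ q ^ j = y ↔ n ∣ j := fun j => by
    rw [hq, pow_card_pow_eq_self_iff_natDegree_minpoly_dvd (F := F), hmin,
      natDegree_minpoly_eq_finrank_of_adjoin_eq_top hθ, hn']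
  obtain ⟨G, hGy, hG⟩ := exists_conjugateProd_eq_mul (F := F) (n := n) (y := y) (by omega) hyj
  have hdeg : ((X - C y) * G).natDegree = δ := by rw [← hG, natDegree_conjugateProd, hδ]
  set v : E → K := fun x =>
    aeval θ (minpoly F x) ^ (Module.finrank F E / (minpoly F x).natDegree) with hv
  have hvG : ∀ x, algebraMap K E (v x) =
      ((X - C y) * G).eval x ^ (c * (Q ^ k + 1)) := by
    intro x
    rw [hc2, hKq, ← hG, eval_conjugateProd_pow ((hyj n).2 dvd_rfl), hv, map_pow,
      ← aeval_algebraMap_apply, ← hy, aeval_minpoly_pow_eq_prod x y (minpoly.degree_dvd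
        (IsIntegral.of_finite F x)), hFE]
    rw [← Finset.prod_congr rfl (fun i _ => neg_sub (x ^ q ^ i) y)]
    rw [Finset.prod_neg, Finset.card_range, Even.neg_one_pow, one_mul]
    exact ⟨n * k, by ring⟩
  have hsum : lPowerSum (MulChar.compAeval (F := F) χ θ) (n * (2 * k)) = ∑ x, χ (v x) := by
    rw [← hFE, lPowerSum_finrank]
    refine Finset.sum_congr rfl fun x _ => ?_
    rw [MulChar.compAeval_apply, hv, map_pow]
  have hfib : ∀ ζ, #{x | v x = ζ} ≤ c * Q ^ k + (8 * (Q - 1) * δ + 2 * δ + 19) * Q ^ k := by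
    intro ζ
    have := card_pow_eval_eq_le p (a * n * k) (Q ^ k) (Q - 1) c
      (by rw [hKq, hq, hFa, ← pow_mul, ← pow_mul, mul_assoc]) hcQ hEQ (by omega) hc3 y G hGy
      (algebraMap K E ζ)
    rw [hdeg] at this
    refine le_trans (le_of_eq ?_) this
    congr 1
    ext x
    simp only [mem_filter, mem_univ, true_and]
    rw [← hvG, (algebraMap K E).injective.eq_iff]
  have hzero : #{x | v x = 0} ≤ δ := by
    rw [← hdeg, ← hG]
    refine le_trans (Finset.card_le_card ?_) (card_roots' _ |> (Multiset.toFinset_card_le _).trans)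
    intro x hx
    rw [Multiset.mem_toFinset, mem_roots (conjugateProd_ne_zero n y), IsRoot, hG]
    have h0 := hvG x
    rw [(mem_filter.1 hx).2, map_zero] at h0
    exact eq_zero_of_pow_eq_zero h0.symm
  have hmain := norm_sum_mulChar_comp_le hχ v _ δ hfib hzero
  rw [hsum]
  refine hmain.trans ?_
  have hQ1 : ((Q - 1 : ℕ) : ℝ) = (Q : ℝ) - 1 := by rw [Nat.cast_sub (by omega)]; simp
  have hcQ' : (Q : ℝ) ^ k = (Q - 1) * c + 1 := by rw [← hQ1]; exact_mod_cast hcQ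
  rw [hEQ]
  push_cast
  rw [hQ1]
  have h1 : (1 : ℝ) ≤ (Q : ℝ) ^ k := one_le_pow₀ (by exact_mod_cast (by omega : 1 ≤ Q))
  have h4 : (4 : ℝ) ≤ Q := by exact_mod_cast hQ4
  generalize hL : (Q : ℝ) ^ k = L at *
  have hδ0 : (0 : ℝ) ≤ δ := by positivity
  have e : ((Q : ℝ) - 1) * (c * L + (8 * (Q - 1) * δ + 2 * δ + 19) * L) - (L ^ 2 - δ) =
      ((Q - 1) * (8 * (Q - 1) * δ + 2 * δ + 19) - 1) * L + δ := by
    have : ((Q : ℝ) - 1) * c = L - 1 := by linarith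
    linear_combination L * this
  rw [e]
  have h5 : ((Q : ℝ) - 1) * (8 * (Q - 1) * δ + 2 * δ + 19) - 1 ≤ Q * (8 * Q * δ + 2 * δ + 19) := by
    nlinarith [mul_nonneg hδ0 (by linarith : (0:ℝ) ≤ Q)]
  nlinarith

end Tower

/-- The power sums of the L-function of `χ (g(θ))` along the multiples of `2 * n` have at most
square root size. -/
theorem exists_norm_lPowerSum_compAeval_le {F K : Type*} [Field F] [Fintype F] [Field K]
    [Fintype K] [Algebra F K] {θ : K} (hθ : Algebra.adjoin F {θ} = ⊤)
    {χ : MulChar K ℂ} (hχ : χ ≠ 1) (hn : 2 ≤ Module.finrank F K) :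
    ∃ B : ℝ, ∀ k, 4 ≤ k →
      ‖lPowerSum (MulChar.compAeval (F := F) χ θ) (Module.finrank F K * (2 * k))‖ ≤
        B * (Fintype.card K : ℝ) ^ k := by
  refine ⟨(Fintype.card K : ℝ) * (8 * Fintype.card K *
    (∑ i ∈ range (Module.finrank F K), Fintype.card F ^ i : ℕ) +
    2 * (∑ i ∈ range (Module.finrank F K), Fintype.card F ^ i : ℕ) + 19) +
    (∑ i ∈ range (Module.finrank F K), Fintype.card F ^ i : ℕ), fun k hk => ?_⟩
  · obtain ⟨p, hpc⟩ := CharP.exists K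
    have : Fact p.Prime := ⟨(FiniteField.card K p).choose_spec.1⟩
    have : NeZero (2 * k) := ⟨by omega⟩
    let : Fintype (FiniteField.Extension K p (2 * k)) := Fintype.ofFinite _
    let : Algebra F (FiniteField.Extension K p (2 * k)) :=
      ((algebraMap K (FiniteField.Extension K p (2 * k))).comp (algebraMap F K)).toAlgebra
    have : IsScalarTower F K (FiniteField.Extension K p (2 * k)) :=
      IsScalarTower.of_algebraMap_eq fun _ => rfl
    exact norm_lPowerSum_compAeval_tower_le (E := FiniteField.Extension K p (2 * k)) hθ hχ hn hk
      (FiniteField.finrank_extension K p (2 * k)) _ rfl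

/-- **The Katz bound**: a nontrivial multiplicative character sum over the translates of a
generator `θ` of `K / F` is at most `(n - 1) √q` in absolute value. -/
theorem norm_sum_mulChar_add_algebraMap_le {F K : Type*} [Field F] [Fintype F] [Field K]
    [Fintype K] [Algebra F K] {θ : K} (hθ : Algebra.adjoin F {θ} = ⊤)
    {χ : MulChar K ℂ} (hχ : χ ≠ 1) (hn : 2 ≤ Module.finrank F K) :
    ‖∑ x : F, χ (θ + algebraMap F K x)‖ ≤
      ((Module.finrank F K : ℝ) - 1) * √(Fintype.card F) := by
  classical
  set n := Module.finrank F K with hn'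
  set ψ : F[X] →* ℂ := MulChar.compAeval χ θ with hψ
  obtain ⟨ω, hω⟩ := exists_eq_neg_sum_pow_of_newton (lCoeff ψ) (lPowerSum ψ) (n - 1)
    (lCoeff_zero ψ) (fun d hd => lCoeff_compAeval_eq_zero hχ hθ (by omega))
    (fun d => mul_lCoeff_eq_sum ψ d)
  obtain ⟨B, hB⟩ := exists_norm_lPowerSum_compAeval_le hθ hχ hn
  have hωle : ∀ i, ‖ω i‖ ≤ √(Fintype.card F) := by
    intro i
    have h := norm_le_of_norm_sum_pow_le (fun i => ω i ^ (2 * n)) (R := Fintype.card K)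
      (B := B) (by positivity) (Filter.eventually_atTop.2 ⟨4, fun k hk => by
        have h1 := hB k hk
        rw [hω _ (by positivity), norm_neg] at h1
        refine le_trans (le_of_eq ?_) h1
        congr 1
        refine Finset.sum_congr rfl fun i _ => ?_
        rw [← pow_mul]
        congr 1
        ring⟩) i
    simp only [norm_pow] at h
    rw [Module.card_eq_pow_finrank (K := F), ← hn', Nat.cast_pow, pow_mul] at h
    exact Real.le_sqrt_of_sq_le (le_of_pow_le_pow_left₀ (by omega) (by positivity) h)
  have h1 := lPowerSum_finrank (F := F) (E := F) ψ
  rw [Module.finrank_self] at h1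
  have h2 : ∑ x : F, χ (θ + algebraMap F K x) = lPowerSum ψ 1 := by
    rw [h1, ← Equiv.sum_comp (Equiv.neg F)]
    refine Finset.sum_congr rfl fun x _ => ?_
    have : minpoly F x = X - C x := minpoly.eq_X_sub_C' x
    rw [this, natDegree_X_sub_C, hψ, MulChar.compAeval_apply]
    simp [sub_eq_add_neg]
  rw [h2, hω 1 one_pos, norm_neg]
  refine (norm_sum_le_of_le _ (f := fun i => ω i ^ 1) (n := fun _ => √(Fintype.card F))
    fun i _ => by simpa using hωle i).trans (le_of_eq ?_)
  rw [Finset.sum_const, Finset.card_univ, Fintype.card_fin, nsmul_eq_mul,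
    Nat.cast_sub (by omega), Nat.cast_one]

theorem exists_mulChar_orderOf_apply_eq (K : Type*) [Field K] [Fintype K] :
    ∃ χ : MulChar K ℂ, orderOf χ = Fintype.card K - 1 ∧
      ∀ w : K, w ≠ 0 → orderOf (χ w) = orderOf w := by
  classical
  have hcard : Fintype.card Kˣ ≠ 0 := Fintype.card_ne_zero
  obtain ⟨χ, hχ⟩ := MulChar.exists_mulChar_orderOf_eq_card_units K
    (Complex.isPrimitiveRoot_exp _ hcard)
  refine ⟨χ, by rw [hχ, Fintype.card_units], fun w hw => orderOf_eq_orderOf_iff.2 fun k => ?_⟩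
  have key : ∀ v : Kˣ, χ v = 1 → v = 1 := by
    obtain ⟨g, hg⟩ := IsCyclic.exists_generator (α := Kˣ)
    intro v hv
    obtain ⟨j, rfl⟩ := Submonoid.mem_powers_iff _ _ |>.1 (mem_powers_iff_mem_zpowers.2 (hg v))
    have h1 : χ ^ j = 1 := by
      rw [MulChar.eq_iff hg, MulChar.one_apply_coe, MulChar.pow_apply_coe, ← hv]
      simp
    have h2 := orderOf_dvd_of_pow_eq_one h1
    rw [hχ] at h2
    exact orderOf_dvd_iff_pow_eq_one.1 ((orderOf_dvd_card).trans h2)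
  constructor
  · intro h
    have := key (Units.mk0 w hw ^ k) (by simpa using h)
    simpa [Units.ext_iff] using this
  · intro h
    rw [← map_pow, h, map_one]

theorem sum_range_mul_filter_dvd {M : Type*} [AddCommMonoid M] {p : ℕ} (hp : 0 < p) (m : ℕ)
    (f : ℕ → M) :
    ∑ j ∈ range (p * m) with p ∣ j, f j = ∑ i ∈ range m, f (p * i) := by
  have h : {j ∈ range (p * m) | p ∣ j} = (range m).image (p * ·) := by
    ext j
    simp only [mem_filter, mem_range, Finset.mem_image]
    constructor
    · rintro ⟨hj, i, rfl⟩
      exact ⟨i, lt_of_mul_lt_mul_left hj hp.le, rfl⟩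
    · rintro ⟨i, hi, rfl⟩
      exact ⟨Nat.mul_lt_mul_of_pos_left hi hp, dvd_mul_right _ _⟩
  rw [h, Finset.sum_image fun i _ j _ hij => Nat.eq_of_mul_eq_mul_left hp hij]

theorem geom_sum_eq_zero_of_pow_eq_one {t : ℂ} (ht : t ≠ 1) {m : ℕ} (hm : t ^ m = 1) :
    ∑ j ∈ range m, t ^ j = 0 := by
  rw [geom_sum_eq ht, hm, sub_self, zero_div]

/-- A sieve weight, supported on the characters of order dividing a power of `p`, detecting the
`p`-part of the order of a root of unity. -/
theorem exists_weight_detecting_factorization_orderOf {N r p : ℕ} (hN : N ≠ 0) (hr : r ∣ N)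
    (hp : p.Prime) :
    ∃ (e : ℕ) (c : ℕ → ℂ), p ^ e ∣ N ∧ c 0 = 1 ∧
      ∑ j ∈ range (p ^ e), ‖c j‖ ≤ (if N.factorization p = r.factorization p then
        (p : ℝ) ^ r.factorization p else 2 * (p : ℝ) ^ r.factorization p) ∧
      ∀ z : ℂ, z ^ N = 1 → ∑ j ∈ range (p ^ e), c j * z ^ (N / p ^ e * j) ≠ 0 →
        (orderOf z).factorization p = N.factorization p - r.factorization p := by
  set a := N.factorization p with ha
  set b := r.factorization p with hb
  have hba : b ≤ a := (Nat.factorization_le_iff_dvd (ne_zero_of_dvd_ne_zero hN hr) hN).2 hr p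
  have hord : ∀ z : ℂ, z ^ N = 1 → orderOf z ≠ 0 := fun z hz =>
    ne_zero_of_dvd_ne_zero hN (orderOf_dvd_of_pow_eq_one hz)
  have hfac : ∀ d, d ≤ a → (N / p ^ d).factorization p = a - d := fun d hd => by
    rw [Nat.factorization_div ((hp.pow_dvd_iff_le_factorization hN).2 hd)]
    simp [hp.factorization_pow, ha]
  have hle : ∀ z : ℂ, ∀ d, d ≤ a → z ^ (N / p ^ d) = 1 → (orderOf z).factorization p ≤ a - d := by
    intro z d hd hz
    have hdvd : p ^ d ∣ N := (hp.pow_dvd_iff_le_factorization hN).2 hd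
    have h0 : N / p ^ d ≠ 0 := (Nat.div_pos (Nat.le_of_dvd (by omega) hdvd)
      (pow_pos hp.pos d)).ne'
    have h := orderOf_dvd_of_pow_eq_one hz
    rw [← hfac d hd]
    exact (Nat.factorization_le_iff_dvd (ne_zero_of_dvd_ne_zero h0 h) h0).2 h p
  by_cases hab : a = b
  · refine ⟨a, fun _ => 1, Nat.ordProj_dvd N p, rfl, ?_, fun z hz hsum => ?_⟩
    · rw [if_pos hab]
      simp [hab]
    · have h1 : z ^ (N / p ^ a) = 1 := by
        by_contra hne
        refine hsum ?_
        simp only [one_mul, pow_mul]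
        refine geom_sum_eq_zero_of_pow_eq_one hne ?_
        rw [← pow_mul, Nat.div_mul_cancel (Nat.ordProj_dvd N p), hz]
      have := hle z a le_rfl h1
      omega
  · have hlt : b + 1 ≤ a := by omega
    have hdvd : p ^ (b + 1) ∣ N := (hp.pow_dvd_iff_le_factorization hN).2 hlt
    have hp1 : (p : ℝ) - 1 > 0 := by
      have : (2 : ℝ) ≤ p := by exact_mod_cast hp.two_le
      linarith
    have hp1' : (p : ℂ) - 1 ≠ 0 := by exact_mod_cast hp1.ne'
    refine ⟨b + 1, fun j => (if p ∣ j then (p : ℂ) / (p - 1) else 0) - 1 / (p - 1), hdvd, ?_, ?_,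
      fun z hz hsum => ?_⟩
    · simp only [dvd_zero, if_true]
      field_simp
    · rw [if_neg hab]
      have h1 : ∀ j, ‖(if p ∣ j then (p : ℂ) / (p - 1) else 0) - 1 / (p - 1)‖ =
          (if p ∣ j then ((p : ℝ) - 2) / (p - 1) else 0) + 1 / (p - 1) := by
        intro j
        have hn : ‖(1 : ℂ) / (p - 1)‖ = 1 / ((p : ℝ) - 1) := by
          have : (1 : ℂ) / (p - 1) = ((1 / ((p : ℝ) - 1) : ℝ) : ℂ) := by push_cast; rfl
          rw [this, Complex.norm_real, Real.norm_of_nonneg (by positivity)]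
        split_ifs
        · rw [← sub_div, div_self hp1', norm_one]
          field_simp
          ring
        · rw [zero_sub, norm_neg, hn, zero_add]
      rw [Finset.sum_congr rfl fun j _ => h1 j, Finset.sum_add_distrib, ← Finset.sum_filter,
        pow_succ', sum_range_mul_filter_dvd hp.pos]
      simp only [Finset.sum_const, Finset.card_range, nsmul_eq_mul]
      push_cast
      refine le_of_eq ?_
      field_simp
      ring
    · set t := z ^ (N / p ^ (b + 1)) with ht
      have htp : z ^ (N / p ^ b) = t ^ p := by
        rw [ht, ← pow_mul]
        congr 1
        obtain ⟨M, hM⟩ := hdvd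
        rw [hM, Nat.mul_div_cancel_left _ (pow_pos hp.pos _), pow_succ, mul_assoc,
          Nat.mul_div_cancel_left _ (pow_pos hp.pos _), mul_comm]
      have htpow : t ^ (p ^ (b + 1)) = 1 := by
        rw [ht, ← pow_mul, Nat.div_mul_cancel hdvd, hz]
      have hval : ∑ j ∈ range (p ^ (b + 1)), ((if p ∣ j then (p : ℂ) / (p - 1) else 0) -
          1 / (p - 1)) * z ^ (N / p ^ (b + 1) * j) =
          (p : ℂ) / (p - 1) * ∑ i ∈ range (p ^ b), (t ^ p) ^ i -
            1 / (p - 1) * ∑ j ∈ range (p ^ (b + 1)), t ^ j := by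
        simp only [pow_mul z, ← ht, sub_mul, Finset.sum_sub_distrib, ite_mul, zero_mul]
        rw [← Finset.sum_filter, ← Finset.mul_sum, ← Finset.mul_sum, pow_succ',
          sum_range_mul_filter_dvd hp.pos]
        simp only [pow_mul]
      rw [hval] at hsum
      have h1 : t ≠ 1 := by
        intro h
        refine hsum ?_
        rw [h]
        simp only [one_pow, Finset.sum_const, Finset.card_range, nsmul_eq_mul, mul_one]
        push_cast
        field_simp
        ring
      have h2 : t ^ p = 1 := by
        by_contra h
        refine hsum ?_
        rw [geom_sum_eq_zero_of_pow_eq_one h1 htpow, geom_sum_eq_zero_of_pow_eq_one h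
          (by rw [← pow_mul, ← pow_succ', htpow])]
        simp
      have h3 := hle z b hba (htp.trans h2)
      refine le_antisymm h3 ?_
      by_contra h4
      refine h1 (orderOf_dvd_iff_pow_eq_one.1 ?_)
      have h5 : orderOf z ∣ N := orderOf_dvd_of_pow_eq_one hz
      have h0 : N / p ^ (b + 1) ≠ 0 := (Nat.div_pos (Nat.le_of_dvd (by omega) hdvd)
        (pow_pos hp.pos _)).ne'
      refine (Nat.factorization_le_iff_dvd (hord z hz) h0).1 fun l => ?_
      by_cases hl : l = p
      · rw [hl, hfac _ hlt]
        omega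
      · rw [Nat.factorization_div hdvd]
        have h6 := (Nat.factorization_le_iff_dvd (hord z hz) hN).2 h5 l
        simpa [hp.factorization_pow, Ne.symm hl] using h6

theorem eq_zero_of_dvd_sum_div_mul {ι : Type*} [Fintype ι] {N : ℕ} (hN : N ≠ 0) {P φ : ι → ℕ}
    (hcop : Pairwise (Function.onFun Nat.Coprime P)) (hP : ∀ i, P i ∣ N) (hφ : ∀ i, φ i < P i)
    (h : N ∣ ∑ i, N / P i * φ i) : φ = 0 := by
  classical
  funext i
  set M := ∏ j ∈ univ.erase i, P j with hM
  have h1 : N ∣ ∑ j, N / P j * φ j * M := by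
    rw [← Finset.sum_mul]
    exact h.mul_right M
  have h2 : N ∣ ∑ j ∈ univ.erase i, N / P j * φ j * M := by
    refine Finset.dvd_sum fun j hj => ?_
    have h3 : P j ∣ M := Finset.dvd_prod_of_mem P hj
    obtain ⟨e, he⟩ := h3
    refine ⟨φ j * e, ?_⟩
    rw [he]
    calc N / P j * φ j * (P j * e) = N / P j * P j * (φ j * e) := by ring
      _ = _ := by rw [Nat.div_mul_cancel (hP j)]
  rw [← Finset.add_sum_erase _ _ (mem_univ i)] at h1
  have h4 : N ∣ N / P i * (φ i * M) := by
    rw [← mul_assoc]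
    exact (Nat.dvd_add_left h2).1 h1
  have h5 : P i ∣ φ i * M := Nat.dvd_of_mul_dvd_mul_left
    (Nat.div_pos (Nat.le_of_dvd (by omega) (hP i)) (by have := hφ i; omega))
    (by rwa [Nat.div_mul_cancel (hP i)])
  have h6 : (P i).Coprime M :=
    Nat.Coprime.prod_right fun j hj => hcop (Finset.ne_of_mem_erase hj).symm
  exact Nat.eq_zero_of_dvd_of_lt (h6.dvd_of_dvd_mul_right h5) (hφ i)

/-- If all nontrivial multiplicative character sums over a family `w` of nonzero elements are
small, then the family contains an `r`-primitive element. -/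
theorem exists_orderOf_eq_div_of_norm_sum_mulChar_le {X K : Type*} [Fintype X] [Field K]
    [Fintype K] {r : ℕ} (hr : r ∣ Fintype.card K - 1) (w : X → K) (hw : ∀ x, w x ≠ 0) {T : ℝ}
    (hT : 0 ≤ T) (h : ∀ χ : MulChar K ℂ, χ ≠ 1 → ‖∑ x, χ (w x)‖ ≤ T)
    (hlt : (∏ p ∈ (Fintype.card K - 1).primeFactors,
      if (Fintype.card K - 1).factorization p = r.factorization p then
        (p : ℝ) ^ r.factorization p else 2 * (p : ℝ) ^ r.factorization p) * T < Fintype.card X) :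
    ∃ x, orderOf (w x) = (Fintype.card K - 1) / r := by
  classical
  set N := Fintype.card K - 1 with hNdef
  have hN : N ≠ 0 := Nat.sub_ne_zero_of_lt Fintype.one_lt_card
  obtain ⟨χ, hχN, hχ⟩ := exists_mulChar_orderOf_apply_eq K
  rw [← hNdef] at hχN
  have hz : ∀ x, χ (w x) ^ N = 1 := fun x => by
    rw [← map_pow, FiniteField.pow_card_sub_one_eq_one _ (hw x), map_one]
  have hweights := fun p : N.primeFactors =>
    exists_weight_detecting_factorization_orderOf hN hr (Nat.prime_of_mem_primeFactors p.2)
  choose e c hdvd hc0 hcsum hc using hweights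
  set R : X → ℂ := fun x => ∏ p : N.primeFactors,
    ∑ j ∈ range ((p : ℕ) ^ e p), c p j * χ (w x) ^ (N / (p : ℕ) ^ e p * j) with hR
  have hexists : ∃ x, R x ≠ 0 := by
    by_contra! hall
    set S := Fintype.piFinset fun p : N.primeFactors => range ((p : ℕ) ^ e p) with hS
    set E : (N.primeFactors → ℕ) → ℕ := fun φ =>
      ∑ p : N.primeFactors, N / (p : ℕ) ^ e p * φ p with hE
    have hexp : ∀ x, R x = ∑ φ ∈ S, (∏ p, c p (φ p)) * χ (w x) ^ E φ := by
      intro x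
      rw [hR, hS]
      simp only [Finset.prod_univ_sum, Finset.prod_mul_distrib, Finset.prod_pow_eq_pow_sum, hE]
    have h0S : (0 : N.primeFactors → ℕ) ∈ S := by
      rw [hS, Fintype.mem_piFinset]
      exact fun p => mem_range.2 (pow_pos (Nat.prime_of_mem_primeFactors p.2).pos _)
    have htotal : ∑ x, R x = 0 := Finset.sum_eq_zero fun x _ => hall x
    rw [Finset.sum_congr rfl fun x _ => hexp x, Finset.sum_comm,
      ← Finset.add_sum_erase _ _ h0S] at htotal
    have hmain : ∑ x, (∏ p, c p ((0 : N.primeFactors → ℕ) p)) *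
        χ (w x) ^ E (0 : N.primeFactors → ℕ) = Fintype.card X := by
      simp [hE, hc0]
    have herr : ∀ φ ∈ S.erase 0, ‖∑ x, (∏ p, c p (φ p)) * χ (w x) ^ E φ‖ ≤
        (∏ p, ‖c p (φ p)‖) * T := by
      intro φ hφ
      obtain ⟨hφ0, hφS⟩ := Finset.mem_erase.1 hφ
      rw [hS, Fintype.mem_piFinset] at hφS
      have hne : χ ^ E φ ≠ 1 := by
        intro h1
        have h2 := orderOf_dvd_of_pow_eq_one h1
        rw [hχN] at h2
        refine hφ0 (eq_zero_of_dvd_sum_div_mul hN ?_ hdvd (fun p => mem_range.1 (hφS p)) h2)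
        intro p p' hpp
        exact Nat.Coprime.pow _ _ ((Nat.coprime_primes (Nat.prime_of_mem_primeFactors p.2)
          (Nat.prime_of_mem_primeFactors p'.2)).2 fun h => hpp (Subtype.ext h))
      have hE0 : E φ ≠ 0 := fun h0 => hne (by rw [h0, pow_zero])
      rw [← Finset.mul_sum, norm_mul, norm_prod]
      refine mul_le_mul_of_nonneg_left ?_ (by positivity)
      have := h _ hne
      simpa only [MulChar.pow_apply' _ hE0] using this
    have hbound : (Fintype.card X : ℝ) ≤ (∏ p : N.primeFactors,
        ∑ j ∈ range ((p : ℕ) ^ e p), ‖c p j‖) * T := by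
      rw [hmain, add_eq_zero_iff_eq_neg] at htotal
      have h1 := congrArg norm htotal
      rw [norm_neg, Complex.norm_natCast] at h1
      rw [h1, Finset.prod_univ_sum, Finset.sum_mul]
      refine (norm_sum_le_of_le _ herr).trans
        (Finset.sum_le_sum_of_subset_of_nonneg (Finset.erase_subset _ _) fun φ _ _ => ?_)
      positivity
    refine absurd (hbound.trans (mul_le_mul_of_nonneg_right ?_ hT)) (not_le.2 hlt)
    exact (Finset.prod_le_prod (fun p _ => Finset.sum_nonneg fun j _ => norm_nonneg _)
      fun p _ => hcsum p).trans_eq (Finset.prod_coe_sort N.primeFactors fun p =>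
        if N.factorization p = r.factorization p then
          (p : ℝ) ^ r.factorization p else 2 * (p : ℝ) ^ r.factorization p)
  obtain ⟨x, hx⟩ := hexists
  refine ⟨x, ?_⟩
  rw [← hχ _ (hw x)]
  have hdvdN : orderOf (χ (w x)) ∣ N := orderOf_dvd_of_pow_eq_one (hz x)
  have hr0 : N / r ≠ 0 := (Nat.div_pos (Nat.le_of_dvd (by omega) hr)
    (Nat.pos_of_ne_zero (ne_zero_of_dvd_ne_zero hN hr))).ne'
  refine Nat.eq_of_factorization_eq (ne_zero_of_dvd_ne_zero hN hdvdN) hr0 fun p => ?_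
  rw [Nat.factorization_div hr]
  by_cases hp : p ∈ N.primeFactors
  · exact hc ⟨p, hp⟩ _ (hz x) (Finset.prod_ne_zero_iff.1 hx _ (mem_univ _))
  · have h1 : N.factorization p = 0 := Finsupp.notMem_support_iff.1 (by simpa using hp)
    have h2 := (Nat.factorization_le_iff_dvd (ne_zero_of_dvd_ne_zero hN hdvdN) hN).2 hdvdN p
    rw [Finsupp.tsub_apply, h1]
    omega

theorem card_divisors_prod_primes {t : Finset ℕ} (ht : ∀ p ∈ t, p.Prime) :
    #(∏ p ∈ t, p).divisors = 2 ^ #t := by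
  have h := ArithmeticFunction.isMultiplicative_sigma (k := 0) |>.map_prod_of_prime t ht
  rw [ArithmeticFunction.sigma_zero_apply] at h
  rw [h, Finset.prod_congr rfl (g := fun _ => 2), Finset.prod_const]
  intro p hp
  rw [ArithmeticFunction.sigma_zero_apply, (ht p hp).divisors, Finset.card_pair (ht p hp).one_lt.ne]

end CharacterSums

theorem stmt_14 (q n r : ℕ) (hq : IsPrimePow q) (hn : 2 ≤ n)
    (hr : r ∣ q ^ n - 1)
    (s u P : ℕ)
    (hs : s = ∏ p ∈ (q ^ n - 1).primeFactors.filter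
        (fun p => (q ^ n - 1).factorization p = r.factorization p ∧
          0 < r.factorization p), p ^ r.factorization p)
    (hu : u = ∏ p ∈ (q ^ n - 1).primeFactors.filter
        (fun p => r.factorization p = 0), p)
    (hP : P = ∏ p ∈ (q ^ n - 1).primeFactors.filter
        (fun p => 0 < r.factorization p ∧
          r.factorization p < (q ^ n - 1).factorization p),
      p ^ (r.factorization p + 1))
    (hq' : ((s * P * u.divisors.card : ℕ) : ℝ) ^ 2 * ((n : ℝ) - 1) ^ 2 < q)
    (F K : Type*) [Field F] [Field K] [Fintype F] [Fintype K] [Algebra F K]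
    (hF : Fintype.card F = q) (hK : Fintype.card K = q ^ n)
    (θ : K) (hθ : Algebra.adjoin F {θ} = ⊤) (α : Kˣ) :
    ∃ x : F, orderOf ((α : K) * (θ + algebraMap F K x)) = (q ^ n - 1) / r := by
  have hfin : Module.finrank F K = n := by
    have h := Module.card_eq_pow_finrank (K := F) (V := K)
    rw [hK, hF] at h
    exact (Nat.pow_right_injective hq.two_le h).symm
  have hn1 : (1 : ℝ) ≤ (n : ℝ) - 1 := by
    have : (2 : ℝ) ≤ n := by exact_mod_cast hn
    linarith
  have hN : Fintype.card K - 1 = q ^ n - 1 := by rw [hK]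
  rw [← hN] at hr hs hu hP ⊢
  refine exists_orderOf_eq_div_of_norm_sum_mulChar_le (T := ((n : ℝ) - 1) * √q) hr
    (fun x : F => (α : K) * (θ + algebraMap F K x)) ?_ (by positivity) ?_ ?_
  · intro x hx
    have h1 : θ = algebraMap F K (-x) := by
      rw [map_neg]
      exact eq_neg_of_add_eq_zero_left ((mul_eq_zero_iff_left α.ne_zero).1 hx)
    have h2 := natDegree_minpoly_eq_finrank_of_adjoin_eq_top hθ
    rw [h1, minpoly.eq_X_sub_C, Polynomial.natDegree_X_sub_C, hfin] at h2
    omega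
  · intro χ hχ
    simp only [map_mul]
    rw [← Finset.mul_sum, norm_mul, ← hfin, ← hF]
    exact (mul_le_of_le_one_left (norm_nonneg _) (norm_mulChar_le_one χ _)).trans
      (norm_sum_mulChar_add_algebraMap_le hθ hχ (by omega))
  · rw [hF]
    have hN0 : Fintype.card K - 1 ≠ 0 := Nat.sub_ne_zero_of_lt Fintype.one_lt_card
    set N := Fintype.card K - 1
    have hW : (∏ p ∈ N.primeFactors, if N.factorization p = r.factorization p then
        (p : ℝ) ^ r.factorization p else 2 * (p : ℝ) ^ r.factorization p) ≤
        ((s * P * u.divisors.card : ℕ) : ℝ) := by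
      rw [hu, card_divisors_prod_primes fun p hp =>
        Nat.prime_of_mem_primeFactors (Finset.mem_filter.1 hp).1, hs, hP, ← Finset.prod_const,
        Finset.prod_filter, Finset.prod_filter, Finset.prod_filter, ← Finset.prod_mul_distrib,
        ← Finset.prod_mul_distrib, Nat.cast_prod]
      refine Finset.prod_le_prod (fun p _ => by positivity) fun p hp => ?_
      have hpp := Nat.prime_of_mem_primeFactors hp
      have hp0 : 0 < N.factorization p := hpp.factorization_pos_of_dvd
        hN0 (Nat.dvd_of_mem_primeFactors hp)
      have hle : r.factorization p ≤ N.factorization p :=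
        (Nat.factorization_le_iff_dvd (ne_zero_of_dvd_ne_zero hN0 hr) hN0).2 hr p
      have hp2 : (2 : ℝ) ≤ p := by exact_mod_cast hpp.two_le
      rcases hle.eq_or_lt with heq | hlt
      · simp [heq, hp0, hp0.ne']
      · rcases Nat.eq_zero_or_pos (r.factorization p) with h0 | h0
        · simp [h0, hp0.ne']
        · rw [if_neg hlt.ne', if_neg fun h => hlt.ne' h.1, if_pos ⟨h0, hlt⟩, if_neg h0.ne',
            one_mul, mul_one, Nat.cast_pow, pow_succ']
          gcongr
    have hq0 : (0 : ℝ) < q := by exact_mod_cast hq.pos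
    have h1 : ((s * P * u.divisors.card : ℕ) : ℝ) * ((n : ℝ) - 1) < √q :=
      Real.lt_sqrt_of_sq_lt (by rwa [mul_pow])
    calc _ ≤ ((s * P * u.divisors.card : ℕ) : ℝ) * (((n : ℝ) - 1) * √q) :=
          mul_le_mul_of_nonneg_right hW (by positivity)
      _ = ((s * P * u.divisors.card : ℕ) : ℝ) * ((n : ℝ) - 1) * √q := by ring
      _ < √q * √q := mul_lt_mul_of_pos_right h1 (Real.sqrt_pos.2 hq0)
      _ = q := Real.mul_self_sqrt hq0.le
end

section
/- Fix integers n ≥ 2 and r ≥ 1. There exists a constant L_r(n) such that for every prime power q > L_r(n) with r | q^n − 1, and for every α ∈ F_{q^n}^* and every θ with F_{q^n} = F_q(θ), there exists x ∈ F_q such that α(θ + x) has multiplicative order (q^n − 1)/r. -/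
open Polynomial

/-- Stepanov's auxiliary polynomial: `∑ a_{j,t,s} (X + θ₀) ^ (s + q t) g ^ j`, where
`g = ∏ (X + θᵢ) ^ mᵢ`. -/
noncomputable def auxPoly {K : Type*} [Field K] (n q : ℕ) (θ : ℕ → K) (m : ℕ → ℕ) {e I D : ℕ}
    (a : Fin e × Fin I × Fin D → K) : K[X] :=
  ∑ p, C (a p) * (X + C (θ 0)) ^ ((p.2.2 : ℕ) + q * (p.2.1 : ℕ)) *
    (∏ i ∈ Finset.range n, (X + C (θ i)) ^ m i) ^ (p.1 : ℕ)

theorem exponent_injective {q e b m₀ I D : ℕ} (heD : e * D ≤ q) (hm : e * m₀ + 1 = q * b) :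
    Function.Injective (fun p : Fin e × Fin I × Fin D =>
      (p.2.2 : ℕ) + q * (p.2.1 : ℕ) + m₀ * (p.1 : ℕ)) := by
  rintro ⟨⟨j, hj⟩, ⟨t, ht⟩, ⟨s, hs⟩⟩ ⟨⟨j', hj'⟩, ⟨t', ht'⟩, ⟨s', hs'⟩⟩ h
  simp only at h
  zify at h hm heD hj hj' hs hs'
  have hq : (q : ℤ) ∣ ((j : ℤ) - j') - e * (s - s') := by
    refine ⟨e * (t - t') + b * (j - j'), ?_⟩
    linear_combination (j - j' : ℤ) * hm - (e : ℤ) * h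
  have hlt : |((j : ℤ) - j') - e * (s - s')| < q := by
    rw [abs_lt]
    constructor <;> nlinarith
  have h0 := Int.eq_zero_of_abs_lt_dvd hq hlt
  have hj0 : (j : ℤ) - j' = 0 := by
    apply Int.eq_zero_of_abs_lt_dvd (m := (e : ℤ)) ⟨s - s', by linarith⟩
    rw [abs_lt]; constructor <;> linarith
  have he : (0 : ℤ) < e := by linarith
  have hs0 : (s : ℤ) - s' = 0 := by
    have : (e : ℤ) * (s - s') = 0 := by linarith
    rcases mul_eq_zero.mp this with h | h <;> linarith
  have hqpos : (0 : ℤ) < q := by nlinarith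
  have hjj : (j : ℤ) = j' := by linarith
  have hss : (s : ℤ) = s' := by linarith
  have htt : (t : ℤ) = t' := by
    rw [hjj, hss] at h
    have : (q : ℤ) * (t - t') = 0 := by linarith
    rcases mul_eq_zero.mp this with h | h <;> linarith
  norm_cast at hjj hss htt
  subst hjj hss htt
  rfl

theorem auxPoly_ne_zero {K : Type*} [Field K] {n q : ℕ} {θ : ℕ → K} {m : ℕ → ℕ} {e I D b : ℕ}
    (hn : 0 < n) (hθ : ∀ i, 0 < i → i < n → θ i ≠ θ 0)
    (heD : e * D ≤ q) (hm : e * m 0 + 1 = q * b)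
    {a : Fin e × Fin I × Fin D → K} (ha : a ≠ 0) : auxPoly n q θ m a ≠ 0 := by
  classical
  intro hR
  set E : Fin e × Fin I × Fin D → ℕ := fun p =>
      (p.2.2 : ℕ) + q * (p.2.1 : ℕ) + m 0 * (p.1 : ℕ) with hE
  have hinj : Function.Injective E := exponent_injective heD hm
  set u : K[X] := ∏ i ∈ (Finset.range n).erase 0, (X + C (θ i)) ^ m i with hu
  have hu0 : u.eval (-θ 0) ≠ 0 := by
    rw [hu, eval_prod, Finset.prod_ne_zero_iff]
    intro i hi
    simp only [Finset.mem_erase, Finset.mem_range] at hi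
    simp only [eval_pow, eval_add, eval_X, eval_C]
    apply pow_ne_zero
    intro h
    exact hθ i (Nat.pos_of_ne_zero hi.1) hi.2 (by linear_combination h)
  have hterm : auxPoly n q θ m a =
      ∑ p, C (a p) * (X + C (θ 0)) ^ E p * u ^ (p.1 : ℕ) := by
    unfold auxPoly
    refine Finset.sum_congr rfl fun p _ => ?_
    rw [← Finset.mul_prod_erase _ _ (Finset.mem_range.mpr hn), hE]
    simp only [pow_add, pow_mul, mul_pow, hu]
    ring
  have hne : (Finset.univ.filter fun p => a p ≠ 0).Nonempty := by
    obtain ⟨p, hp⟩ := Function.ne_iff.mp ha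
    exact ⟨p, by simpa using hp⟩
  obtain ⟨p₀, hp₀, hmin⟩ := Finset.exists_min_image _ E hne
  simp only [Finset.mem_filter, Finset.mem_univ, true_and] at hp₀ hmin
  have hdvd : (X + C (θ 0)) ^ (E p₀ + 1) ∣ C (a p₀) * (X + C (θ 0)) ^ E p₀ * u ^ (p₀.1 : ℕ) := by
    rw [hterm, ← Finset.add_sum_erase _ _ (Finset.mem_univ p₀)] at hR
    rw [eq_neg_of_add_eq_zero_left hR, dvd_neg]
    refine Finset.dvd_sum fun p hp => ?_
    by_cases hap : a p = 0
    · simp [hap]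
    · have h1 := hmin p hap
      have h2 : E p₀ ≠ E p := fun h => (Finset.ne_of_mem_erase hp) (hinj h).symm
      exact Dvd.dvd.mul_right (Dvd.dvd.mul_left (pow_dvd_pow _ (by omega)) _) _
  rw [pow_succ, mul_comm (C (a p₀)), mul_assoc] at hdvd
  have := (mul_dvd_mul_iff_left (pow_ne_zero _ (X_add_C_ne_zero (θ 0)))).mp hdvd
  have h0 := eval_dvd (x := -θ 0) this
  simp only [eval_add, eval_X, eval_C, neg_add_cancel, eval_mul, eval_pow, zero_dvd_iff] at h0
  exact mul_ne_zero hp₀ (pow_ne_zero _ hu0) h0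

/-- Coefficient `k` (in the outer variable) has degree at most `d + w * k`. -/
def WeightLE {K : Type*} [Field K] (w d : ℕ) (p : K[X][X]) : Prop :=
  ∀ k, (p.coeff k).natDegree ≤ d + w * k

namespace WeightLE
variable {K : Type*} [Field K] {w d d' : ℕ} {p p' : K[X][X]}

theorem mono (h : WeightLE w d p) (hd : d ≤ d') : WeightLE w d' p :=
  fun k => (h k).trans (by omega)

theorem mul (h : WeightLE w d p) (h' : WeightLE w d' p') : WeightLE w (d + d') (p * p') := by
  intro k
  rw [coeff_mul]
  refine natDegree_sum_le_of_forall_le _ _ fun ij hij => ?_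
  rw [← Finset.HasAntidiagonal.mem_antidiagonal.mp hij]
  have := h ij.1
  have := h' ij.2
  refine natDegree_mul_le.trans ?_
  rw [mul_add]; omega

theorem C (P : K[X]) : WeightLE w P.natDegree (C P) := by
  intro k
  rw [coeff_C]
  split_ifs <;> simp

theorem pow (h : WeightLE w 0 p) (j : ℕ) : WeightLE w 0 (p ^ j) := by
  induction j with
  | zero => simpa using C (w := w) (1 : K[X])
  | succ j ih => simpa [pow_succ] using ih.mul h

theorem sum {ι : Type*} (s : Finset ι) (f : ι → K[X][X]) (h : ∀ i ∈ s, WeightLE w d (f i)) :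
    WeightLE w d (∑ i ∈ s, f i) := by
  intro k
  rw [finsetSum_coeff]
  exact natDegree_sum_le_of_forall_le _ _ fun i hi => h i hi k

theorem prod {ι : Type*} (s : Finset ι) (f : ι → K[X][X]) (h : ∀ i ∈ s, WeightLE w 0 (f i)) :
    WeightLE w 0 (∏ i ∈ s, f i) := by
  classical
  induction s using Finset.induction_on with
  | empty => simpa using C (w := w) (1 : K[X])
  | insert i s hi ih =>
    rw [Finset.prod_insert hi]
    exact (h i (by simp)).mul (ih fun j hj => h j (by simp [hj]))

theorem one_add_C_mul_X {P : K[X]} (hP : P.natDegree ≤ w) :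
    WeightLE w 0 (1 + Polynomial.C P * X) := by
  intro k
  rcases k with _ | _ | k <;> simp [coeff_one, coeff_X, hP]

end WeightLE

/-- The product of the `X + θᵢ` over `i ≠ l`. -/
noncomputable def cofactor {K : Type*} [Field K] (n : ℕ) (θ : ℕ → K) (l : ℕ) : K[X] :=
  ∏ i ∈ (Finset.range n).erase l, (X + C (θ i))

theorem natDegree_cofactor_le {K : Type*} [Field K] (n : ℕ) (θ : ℕ → K) (l : ℕ) :
    (cofactor n θ l).natDegree ≤ n := by
  unfold cofactor
  refine (natDegree_prod_le _ _).trans ?_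
  simp only [natDegree_X_add_C, Finset.sum_const, smul_eq_mul, mul_one]
  exact Finset.card_erase_le.trans (by simp)

/-- With `Z` the outer variable and `f = ∏ (X + θᵢ)`, the terms of `auxPoly` at `X + f Z` modulo
`Z ^ q`, after replacing `g` by the constant `c` and `(X + θ₀) ^ q` by `X + θ'`. -/
noncomputable def expansionPoly {K : Type*} [Field K] (n : ℕ) (θ : ℕ → K) (m : ℕ → ℕ) (c θ' : K)
    {e I D : ℕ} (p : Fin e × Fin I × Fin D) : K[X][X] :=
  C (C (c ^ (p.1 : ℕ)) * (X + C (θ 0)) ^ (p.2.2 : ℕ) * (X + C θ') ^ (p.2.1 : ℕ)) *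
    ((1 + C (cofactor n θ 0) * X) ^ (p.2.2 : ℕ) *
      ∏ l ∈ Finset.range n, ((1 + C (cofactor n θ l) * X) ^ m l) ^ (p.1 : ℕ))

theorem weightLE_expansionPoly {K : Type*} [Field K] (n : ℕ) (θ : ℕ → K) (m : ℕ → ℕ) (c θ' : K)
    {e I D : ℕ} (p : Fin e × Fin I × Fin D) :
    WeightLE n (D + I - 1) (expansionPoly n θ m c θ' p) := by
  unfold expansionPoly
  have h1 : ((C (c ^ (p.1 : ℕ)) * (X + C (θ 0)) ^ (p.2.2 : ℕ) *
      (X + C θ') ^ (p.2.1 : ℕ) : K[X])).natDegree ≤ D + I - 1 := by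
    refine natDegree_mul_le.trans ?_
    have h2 := natDegree_C_mul_le (c ^ (p.1 : ℕ)) ((X + C (θ 0)) ^ (p.2.2 : ℕ))
    have h3 := natDegree_pow_X_add_C (p.2.2 : ℕ) (θ 0)
    have h4 := natDegree_pow_X_add_C (p.2.1 : ℕ) θ'
    have := p.2.2.2
    have := p.2.1.2
    omega
  have h2 := fun l => WeightLE.one_add_C_mul_X (natDegree_cofactor_le n θ l)
  exact ((WeightLE.C _).mono h1).mul (((h2 0).pow _).mul
    (WeightLE.prod _ _ fun l _ => ((h2 l).pow _).pow _))

theorem exists_coeffs {K : Type*} [Field K] (n : ℕ) (θ : ℕ → K) (m : ℕ → ℕ) (c θ' : K)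
    {e I D M : ℕ} (h : M * (D + I + n * M) < e * I * D) :
    ∃ a : Fin e × Fin I × Fin D → K, a ≠ 0 ∧
      ∀ k < M, (∑ p, C (C (a p)) * expansionPoly n θ m c θ' p).coeff k = 0 := by
  let f : (Fin e × Fin I × Fin D → K) →ₗ[K] (Fin M × Fin (D + I + n * M) → K) :=
    LinearMap.pi fun kd => ∑ p,
      (((expansionPoly n θ m c θ' p).coeff kd.1).coeff kd.2) • LinearMap.proj p
  have hlt : Module.finrank K (Fin M × Fin (D + I + n * M) → K) <
      Module.finrank K (Fin e × Fin I × Fin D → K) := by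
    simpa [Module.finrank_fintype_fun_eq_card, mul_assoc] using h
  obtain ⟨a, haf, ha0⟩ := (Submodule.ne_bot_iff _).mp (LinearMap.ker_ne_bot_of_finrank_lt hlt (f := f))
  refine ⟨a, ha0, fun k hk => ?_⟩
  have hw : WeightLE n (D + I - 1) (∑ p, C (C (a p)) * expansionPoly n θ m c θ' p) := by
    refine WeightLE.sum _ _ fun p _ => ?_
    have := (WeightLE.C (w := n) (C (a p))).mul (weightLE_expansionPoly n θ m c θ' p)
    simpa using this
  ext d
  rw [coeff_zero]
  by_cases hd : d < D + I + n * M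
  · have := congrFun (LinearMap.mem_ker.mp haf) (⟨k, hk⟩, ⟨d, hd⟩)
    simp only [f, LinearMap.pi_apply, LinearMap.sum_apply, LinearMap.smul_apply,
      LinearMap.proj_apply, smul_eq_mul, Pi.zero_apply] at this
    rw [finsetSum_coeff, finsetSum_coeff, ← this]
    refine Finset.sum_congr rfl fun p _ => ?_
    rw [coeff_C_mul, coeff_C_mul, mul_comm]
  · apply coeff_eq_zero_of_natDegree_lt
    have h1 := hw k
    have : n * k ≤ n * M := Nat.mul_le_mul_left _ hk.le
    have hDI : 0 < D + I := by
      by_contra h0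
      have : D = 0 := by omega
      subst this
      simp at h
    omega

theorem X_sub_C_pow_dvd_auxPoly {K : Type*} [Field K] {n q : ℕ} {θ : ℕ → K} {m : ℕ → ℕ}
    {c θ' : K} {e I D M : ℕ} (hn : 0 < n) (hq : ∀ A B : K[X], (A + B) ^ q = A ^ q + B ^ q)
    (hM : M ≤ q) (a : Fin e × Fin I × Fin D → K)
    (ha : ∀ k < M, (∑ p, C (C (a p)) * expansionPoly n θ m c θ' p).coeff k = 0)
    {x : K} (hx : ∀ i < n, x + θ i ≠ 0) (hxc : ∏ i ∈ Finset.range n, (x + θ i) ^ m i = c)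
    (hxq : (x + θ 0) ^ q = x + θ') :
    (X - C x) ^ M ∣ auxPoly n q θ m a := by
  set f : K := ∏ i ∈ Finset.range n, (x + θ i) with hf
  have hf0 : f ≠ 0 := Finset.prod_ne_zero_iff.mpr fun i hi => hx i (Finset.mem_range.mp hi)
  set g : ℕ → K := fun l => (cofactor n θ l).eval x with hg
  have hfg : ∀ l < n, f = (x + θ l) * g l := by
    intro l hl
    simp only [hg, hf, cofactor, eval_prod, eval_add, eval_X, eval_C]
    exact (Finset.mul_prod_erase _ _ (Finset.mem_range.mpr hl)).symm
  clear_value f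
  have hlin : ∀ l < n, (C x + C f * X + C (θ l) : K[X]) = C (x + θ l) * (1 + C (g l) * X) := by
    intro l hl
    rw [hfg l hl]; simp only [C_add, C_mul]; ring
  have hW : (X : K[X]) ^ M ∣
      (∑ p, C (C (a p)) * expansionPoly n θ m c θ' p).map (evalRingHom x) := by
    rw [X_pow_dvd_iff]
    intro k hk
    rw [coeff_map, ha k hk, map_zero]
  have hcomp : (X : K[X]) ^ M ∣ (auxPoly n q θ m a).comp (C x + C f * X) := by
    refine (dvd_iff_dvd_of_dvd_sub ?_).mpr hW
    rw [auxPoly, sum_comp, Polynomial.map_sum, ← Finset.sum_sub_distrib]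
    refine Finset.dvd_sum fun p _ => ?_
    have e1 : (C (a p) * (X + C (θ 0)) ^ ((p.2.2 : ℕ) + q * (p.2.1 : ℕ)) *
        (∏ i ∈ Finset.range n, (X + C (θ i)) ^ m i) ^ (p.1 : ℕ)).comp (C x + C f * X) =
        C (a p * (x + θ 0) ^ (p.2.2 : ℕ) * c ^ (p.1 : ℕ)) * ((1 + C (g 0) * X) ^ (p.2.2 : ℕ) *
          ∏ l ∈ Finset.range n, ((1 + C (g l) * X) ^ m l) ^ (p.1 : ℕ)) *
          (C (x + θ') + C (f ^ q) * X ^ q) ^ (p.2.1 : ℕ) := by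
      have e2 : ((X + C (θ 0)).comp (C x + C f * X)) ^ q = C (x + θ') + C (f ^ q) * X ^ q := by
        rw [← hxq, add_comp, X_comp, C_comp,
          show (C x + C f * X + C (θ 0) : K[X]) = C (x + θ 0) + C f * X by
            simp only [C_add]; ring, hq, mul_pow, C_pow, C_pow]
      have e3 : (∏ i ∈ Finset.range n, (X + C (θ i)) ^ m i).comp (C x + C f * X) =
          C c * ∏ l ∈ Finset.range n, (1 + C (g l) * X) ^ m l := by
        rw [prod_comp, ← hxc, map_prod, ← Finset.prod_mul_distrib]
        refine Finset.prod_congr rfl fun l hl => ?_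
        rw [pow_comp, add_comp, X_comp, C_comp, hlin l (Finset.mem_range.mp hl), mul_pow, C_pow]
      rw [mul_comp, mul_comp, pow_comp, pow_comp, C_comp, pow_add, pow_mul, e2, e3, add_comp,
        X_comp, C_comp, hlin 0 hn, mul_pow, mul_pow, Finset.prod_pow]
      simp only [C_mul, C_pow]
      ring
    have e4 : (C (C (a p)) * expansionPoly n θ m c θ' p).map (evalRingHom x) =
        C (a p * (x + θ 0) ^ (p.2.2 : ℕ) * c ^ (p.1 : ℕ)) * ((1 + C (g 0) * X) ^ (p.2.2 : ℕ) *
          ∏ l ∈ Finset.range n, ((1 + C (g l) * X) ^ m l) ^ (p.1 : ℕ)) *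
          C (x + θ') ^ (p.2.1 : ℕ) := by
      simp only [expansionPoly, Polynomial.map_mul, map_C, Polynomial.map_pow, Polynomial.map_add,
        Polynomial.map_one, map_X, Polynomial.map_prod, coe_evalRingHom,
        eval_add, eval_X, eval_C, C_mul, C_pow, hg]
      ring
    rw [e1, e4, ← mul_sub]
    refine Dvd.dvd.mul_left (dvd_trans ?_ (sub_dvd_pow_sub_pow _ _ _)) _
    rw [add_sub_cancel_left]
    exact Dvd.dvd.mul_left (pow_dvd_pow _ hM) _
  obtain ⟨Q, hQ⟩ := hcomp
  have h2 := congrArg (fun P => P.comp (C f⁻¹ * (X - C x))) hQ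
  simp only [comp_assoc] at h2
  have h3 : (C x + C f * X : K[X]).comp (C f⁻¹ * (X - C x)) = X := by
    simp only [add_comp, mul_comp, C_comp, X_comp]
    rw [← mul_assoc, ← C_mul, mul_inv_cancel₀ hf0]; simp
  rw [h3, comp_X, mul_comp, pow_comp, X_comp, mul_pow] at h2
  rw [h2]
  exact Dvd.dvd.mul_right (Dvd.dvd.mul_left dvd_rfl _) _

theorem natDegree_auxPoly_le {K : Type*} [Field K] {n q : ℕ} {θ : ℕ → K} {m : ℕ → ℕ} {e I D : ℕ}
    (hm : ∀ i < n, m i ≤ q) (a : Fin e × Fin I × Fin D → K) :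
    (auxPoly n q θ m a).natDegree ≤ D + q * I + e * (n * q) := by
  refine natDegree_sum_le_of_forall_le _ _ fun p _ => ?_
  have h0 : (∏ i ∈ Finset.range n, (X + C (θ i)) ^ m i).natDegree ≤ n * q := by
    refine (natDegree_prod_le _ _).trans ?_
    simp only [natDegree_pow_X_add_C]
    calc _ ≤ ∑ i ∈ Finset.range n, q := Finset.sum_le_sum fun i hi => hm i (Finset.mem_range.mp hi)
      _ = _ := by simp
  refine natDegree_mul_le.trans (add_le_add ((natDegree_C_mul_le _ _).trans ?_)
    (natDegree_pow_le.trans (Nat.mul_le_mul p.1.2.le h0)))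
  rw [natDegree_pow_X_add_C]
  exact add_le_add p.2.2.2.le (Nat.mul_le_mul_left _ p.2.1.2.le)

/-- Stepanov's bound: a nonzero auxiliary polynomial vanishes to order `M` on `B`. -/
theorem card_mul_le {K : Type*} [Field K] {n q : ℕ} {θ : ℕ → K} {m : ℕ → ℕ} {c θ' : K}
    {e I D M b : ℕ} (hn : 0 < n) (hq : ∀ A B : K[X], (A + B) ^ q = A ^ q + B ^ q)
    (hθ : ∀ i, 0 < i → i < n → θ i ≠ θ 0) (heD : e * D ≤ q) (hm : e * m 0 + 1 = q * b)
    (hmq : ∀ i < n, m i ≤ q) (hM : M ≤ q) (h : M * (D + I + n * M) < e * I * D)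
    (B : Finset K) (hx : ∀ x ∈ B, ∀ i < n, x + θ i ≠ 0)
    (hxc : ∀ x ∈ B, ∏ i ∈ Finset.range n, (x + θ i) ^ m i = c)
    (hxq : ∀ x ∈ B, (x + θ 0) ^ q = x + θ') :
    B.card * M ≤ D + q * I + e * (n * q) := by
  obtain ⟨a, ha0, ha⟩ := exists_coeffs n θ m c θ' h
  have hR := auxPoly_ne_zero hn hθ heD hm ha0
  refine le_trans ?_ (natDegree_auxPoly_le (θ := θ) hmq a)
  have hdvd : ∏ x ∈ B, (X - C x) ^ M ∣ auxPoly n q θ m a := by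
    refine Finset.prod_dvd_of_coprime ?_ fun x hxB =>
      X_sub_C_pow_dvd_auxPoly hn hq hM a ha (hx x hxB) (hxc x hxB) (hxq x hxB)
    intro x _ y _ hxy
    exact (pairwise_coprime_X_sub_C Function.injective_id hxy).pow
  have := natDegree_le_of_dvd hdvd hR
  rw [natDegree_prod_of_monic _ _ fun x _ => (monic_X_sub_C x).pow M] at this
  simpa using this

section Arithmetic

variable {c e q s n S D : ℕ}

theorem mul_sqrt_le_of_mul_le (hn : 0 < n) (he : 0 < e) (hS : s = S + 4 * n * e ^ 2)
    (hes : 8 * n * e ^ 2 ≤ s) (hD : D ≤ q) (h : c * (e * S) ≤ D + q * s + e * (n * q)) :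
    c * e * s ≤ q * (s + 12 * n * e ^ 2) := by
  have hu : 0 < n * e ^ 2 := by positivity
  have hne : n * e ≤ n * e ^ 2 := Nat.mul_le_mul_left _ (Nat.le_self_pow (by norm_num) e)
  have h1 : c * e * S ≤ q * (1 + s + e * n) := by
    calc c * e * S = c * (e * S) := by ring
      _ ≤ q + q * s + e * (n * q) := h.trans (by lia)
      _ = _ := by ring
  have h2 : s * (1 + s + e * n) ≤ S * (s + 12 * n * e ^ 2) := by
    have h3 : 1 + e * n ≤ 2 * (n * e ^ 2) := by lia
    have h4 : 4 * (n * e ^ 2) ≤ S := by lia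
    rw [show 12 * n * e ^ 2 = 12 * (n * e ^ 2) by ring]
    rw [show 4 * n * e ^ 2 = 4 * (n * e ^ 2) by ring] at hS
    generalize n * e ^ 2 = u at h3 h4 hS
    rw [hS]
    calc (S + 4 * u) * (1 + (S + 4 * u) + e * n) ≤ (S + 4 * u) * (S + 6 * u) :=
          Nat.mul_le_mul_left _ (by lia)
      _ ≤ S * (S + 4 * u + 12 * u) := by nlinarith [Nat.mul_le_mul_left u h4]
  refine Nat.le_of_mul_le_mul_right ?_ (show 0 < S by lia)
  calc c * e * s * S = c * e * S * s := by ring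
    _ ≤ q * (1 + s + e * n) * s := Nat.mul_le_mul_right _ h1
    _ = q * (s * (1 + s + e * n)) := by ring
    _ ≤ q * (S * (s + 12 * n * e ^ 2)) := Nat.mul_le_mul_left _ h2
    _ = _ := by ring

theorem le_of_eight_mul_sq_le (hn : 0 < n) (hes : 8 * n * e ^ 2 ≤ s) : 8 * e ≤ s := by
  have h1 : e ≤ e ^ 2 := Nat.le_self_pow (by norm_num) e
  have h2 : e ^ 2 ≤ n * e ^ 2 := Nat.le_mul_of_pos_left _ hn
  lia

theorem mul_le_of_sqrt (hn : 0 < n) (hS : s = S + 4 * n * e ^ 2)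
    (hes : 8 * n * e ^ 2 ≤ s) (hss : s * s ≤ q) : e * S ≤ q := by
  have h1 := le_of_eight_mul_sq_le hn hes
  exact (Nat.mul_le_mul (show e ≤ s by lia) (show S ≤ s by lia)).trans hss

theorem unknowns_gt_conditions (hn : 0 < n) (he : 0 < e) (hS : s = S + 4 * n * e ^ 2)
    (hes : 8 * n * e ^ 2 ≤ s) (hss : s * s ≤ q) :
    e * S * (q / e + s + n * (e * S)) < e * s * (q / e) := by
  have hse := le_of_eight_mul_sq_le hn hes
  have hDgt : q < e * (q / e) + e := Nat.lt_mul_div_succ q he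
  have hqe : 64 * e ≤ q := by nlinarith
  have hSs : S ≤ s := by lia
  have h2 : S * s ≤ q := (Nat.mul_le_mul_right _ hSs).trans hss
  have h3 : n * e * (S * S) ≤ n * e * q :=
    Nat.mul_le_mul_left _ ((Nat.mul_le_mul hSs hSs).trans hss)
  have h4 : q ≤ n * e * q := Nat.le_mul_of_pos_left _ (by positivity)
  have h5 : q < 2 * (e * (q / e)) := by lia
  have h6 : n * e * q < n * e * (2 * (e * (q / e))) :=
    Nat.mul_lt_mul_of_pos_left h5 (by positivity)
  calc e * S * (q / e + s + n * (e * S))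
      = e * (S * (q / e) + (S * s + n * e * (S * S))) := by ring
    _ < e * (S * (q / e) + 2 * (n * e * (2 * (e * (q / e))))) :=
        Nat.mul_lt_mul_of_pos_left (by lia) he
    _ = e * s * (q / e) := by rw [hS]; ring

end Arithmetic

section FiniteFields

theorem sum_digits (m q n : ℕ) : ∑ i ∈ Finset.range n, m / q ^ i % q * q ^ i = m % q ^ n := by
  induction n with
  | zero => simp [Nat.mod_one]
  | succ n ih => rw [Finset.sum_range_succ, ih, Nat.mod_pow_succ, mul_comm (q ^ n)]

variable {F K : Type} [Field F] [Field K] [Fintype F] [Algebra F K] {q n : ℕ}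

theorem add_pow_card_eq (hF : Fintype.card F = q) (R : Type) [CommRing R] [Algebra F R]
    [Nontrivial R] (A B : R) : (A + B) ^ q = A ^ q + B ^ q := by
  obtain ⟨p, hp⟩ := CharP.exists F
  obtain ⟨k, hpp, hk⟩ := FiniteField.card F p
  have := Fact.mk hpp
  have : CharP R p := charP_of_injective_algebraMap (algebraMap F R).injective p
  rw [← hF, hk]
  exact add_pow_char_pow A B p k

theorem algebraMap_pow_card_pow (hF : Fintype.card F = q) (x : F) (i : ℕ) :
    (algebraMap F K x) ^ q ^ i = algebraMap F K x := by
  rw [← map_pow, ← hF, FiniteField.pow_card_pow]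

theorem add_pow_card_pow_eq (hF : Fintype.card F = q) (θ : K) (x : F) (i : ℕ) :
    (θ + algebraMap F K x) ^ q ^ i = algebraMap F K x + θ ^ q ^ i := by
  induction i with
  | zero => simp [add_comm]
  | succ i ih =>
    rw [pow_succ, pow_mul, ih, add_pow_card_eq hF, ← pow_mul, ← map_pow, ← hF,
      FiniteField.pow_card, hF]

open Classical in
/-- The points of the line whose `k`-th power is `ζ`. -/
noncomputable def linePowFiber (α θ : K) (k : ℕ) (ζ : K) : Finset F :=
  Finset.univ.filter fun x => (α * (θ + algebraMap F K x)) ^ k = ζ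

theorem mem_linePowFiber {α θ : K} {k : ℕ} {ζ : K} {x : F} :
    x ∈ linePowFiber α θ k ζ ↔ (α * (θ + algebraMap F K x)) ^ k = ζ := by
  simp [linePowFiber]

variable [Fintype K]

theorem pow_ne_self_of_adjoin (hF : Fintype.card F = q) (hK : Fintype.card K = q ^ n) {θ : K}
    (hθ : Algebra.adjoin F {θ} = ⊤) {i : ℕ} (hi : 0 < i) (hin : i < n) : θ ^ q ^ i ≠ θ := by
  intro h
  have hq : 1 < q := hF ▸ Fintype.one_lt_card
  have hfin : Module.finrank F K = n := by
    have := Module.card_eq_pow_finrank (K := F) (V := K)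
    rw [hF, hK] at this
    exact (Nat.pow_right_injective hq this).symm
  have h1 : FiniteField.frobeniusAlgHom F K ^ i = 1 := by
    refine AlgHom.ext_of_adjoin_eq_top hθ ?_
    intro y hy
    rw [Set.mem_singleton_iff] at hy
    subst hy
    have : ∀ j, (FiniteField.frobeniusAlgHom F K ^ j) y = y ^ q ^ j := by
      intro j
      induction j with
      | zero => simp
      | succ j ih =>
        rw [pow_succ', AlgHom.mul_apply, ih, FiniteField.coe_frobeniusAlgHom, hF]
        change (y ^ q ^ j) ^ q = _
        rw [← pow_mul, pow_succ]
    rw [this, h]; rfl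
  have h2 := orderOf_dvd_of_pow_eq_one h1
  rw [FiniteField.orderOf_frobeniusAlgHom, hfin] at h2
  exact absurd (Nat.le_of_dvd hi h2) (by omega)

theorem add_algebraMap_ne_zero (hn : 2 ≤ n) (hF : Fintype.card F = q)
    (hK : Fintype.card K = q ^ n) {θ : K} (hθ : Algebra.adjoin F {θ} = ⊤) (x : F) :
    θ + algebraMap F K x ≠ 0 := by
  intro h
  apply pow_ne_self_of_adjoin hF hK hθ one_pos (by omega)
  have : θ = algebraMap F K (-x) := by rw [map_neg]; linear_combination h
  rw [this, algebraMap_pow_card_pow hF]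

theorem card_linePowFiber_le (hn : 2 ≤ n) (hF : Fintype.card F = q)
    (hK : Fintype.card K = q ^ n) {α θ : K} (hα : α ≠ 0) (hθ : Algebra.adjoin F {θ} = ⊤)
    {e : ℕ} (he : e ∣ q ^ n - 1) (hes : 8 * n * e ^ 2 ≤ q.sqrt) (ζ : K) :
    (linePowFiber (F := F) α θ ((q ^ n - 1) / e) ζ).card * e * q.sqrt ≤
      q * (q.sqrt + 12 * n * e ^ 2) := by
  classical
  have hq1 : 1 < q := hF ▸ Fintype.one_lt_card
  have hqn : 1 < q ^ n := Nat.one_lt_pow (by omega) hq1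
  have he0 : 0 < e := Nat.pos_of_dvd_of_pos he (by omega)
  set k := (q ^ n - 1) / e with hk
  have hek : e * k = q ^ n - 1 := Nat.mul_div_cancel' he
  have hklt : k < q ^ n := (Nat.div_le_self _ _).trans_lt (by omega)
  set s := q.sqrt with hs
  have hss : s * s ≤ q := Nat.sqrt_le q
  obtain ⟨S, hS⟩ : ∃ S, s = S + 4 * n * e ^ 2 := ⟨s - 4 * n * e ^ 2, by lia⟩
  have hn0 : 0 < n := by omega
  obtain ⟨b, hb⟩ : q ∣ e * (k / q ^ 0 % q) + 1 := by
    have h1 : e * (k / q ^ 0 % q) + 1 ≡ e * k + 1 [MOD q] := by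
      rw [pow_zero, Nat.div_one]
      exact ((Nat.mod_modEq k q).mul_left e).add_right 1
    refine (Nat.modEq_zero_iff_dvd.mp (h1.trans ?_))
    rw [hek, Nat.sub_add_cancel hqn.le]
    exact Nat.modEq_zero_iff_dvd.mpr (dvd_pow_self q (by omega))
  have key := card_mul_le (K := K) (n := n) (q := q) (θ := fun i => θ ^ q ^ i)
    (m := fun i => k / q ^ i % q) (c := ζ * (α ^ k)⁻¹) (θ' := θ ^ q ^ 1)
    (e := e) (I := s) (D := q / e) (M := e * S) (b := b) (by omega)
    (fun A B => add_pow_card_eq hF K[X] A B)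
    (fun i hi hin => by simpa using pow_ne_self_of_adjoin hF hK hθ hi hin)
    (Nat.mul_div_le q e) hb (fun i _ => (Nat.mod_lt _ (by omega)).le)
    (mul_le_of_sqrt hn0 hS hes hss)
    (unknowns_gt_conditions hn0 he0 hS hes hss)
    ((linePowFiber (F := F) α θ k ζ).image (algebraMap F K))
    (by
      simp only [Finset.forall_mem_image]
      intro x _ i _
      rw [← add_pow_card_pow_eq hF]
      exact pow_ne_zero _ (add_algebraMap_ne_zero hn hF hK hθ x))
    (by
      simp only [Finset.forall_mem_image]
      intro x hx
      rw [mem_linePowFiber, mul_pow] at hx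
      rw [← hx, mul_comm (α ^ k), mul_inv_cancel_right₀ (pow_ne_zero _ hα)]
      simp only [← add_pow_card_pow_eq hF, ← pow_mul]
      rw [Finset.prod_pow_eq_pow_sum]
      congr 1
      rw [← Nat.mod_eq_of_lt hklt, ← sum_digits k q n]
      exact Finset.sum_congr rfl fun i _ => by
        rw [mul_comm, sum_digits, Nat.mod_eq_of_lt hklt])
    (by
      simp only [Finset.forall_mem_image]
      intro x hx
      rw [← add_pow_card_pow_eq hF θ x 1, pow_zero, pow_one, pow_one, add_comm])
  rw [Finset.card_image_of_injective _ (algebraMap F K).injective] at key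
  exact mul_sqrt_le_of_mul_le hn0 he0 hS hes (Nat.div_le_self _ _) key

theorem card_pow_eq_one_le {k : ℕ} (hk : 0 < k) [DecidableEq K] :
    (Finset.univ.filter fun ζ : K => ζ ^ k = 1).card ≤ k := by
  refine le_trans (Finset.card_le_card ?_)
    ((Multiset.toFinset_card_le (nthRoots k (1 : K))).trans (card_nthRoots k 1))
  intro ζ hζ
  simpa [mem_nthRoots hk] using hζ

theorem le_card_linePowFiber (hn : 2 ≤ n) (hF : Fintype.card F = q)
    (hK : Fintype.card K = q ^ n) {α θ : K} (hα : α ≠ 0) (hθ : Algebra.adjoin F {θ} = ⊤)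
    {e : ℕ} (he : e ∣ q ^ n - 1) (hes : 8 * n * e ^ 2 ≤ q.sqrt) {ζ : K} (hζ : ζ ^ e = 1) :
    q * q.sqrt ≤ (linePowFiber (F := F) α θ ((q ^ n - 1) / e) ζ).card * e * q.sqrt +
      12 * n * e ^ 3 * q := by
  classical
  have hq1 : 1 < q := hF ▸ Fintype.one_lt_card
  have hqn : 1 < q ^ n := Nat.one_lt_pow (by omega) hq1
  have he0 : 0 < e := Nat.pos_of_dvd_of_pos he (by omega)
  set k := (q ^ n - 1) / e with hk
  have hek : k * e = q ^ n - 1 := Nat.div_mul_cancel he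
  set T := Finset.univ.filter fun ζ : K => ζ ^ e = 1
  have hT : T.card ≤ e := card_pow_eq_one_le he0
  have hmaps : ∀ x ∈ (Finset.univ : Finset F), (α * (θ + algebraMap F K x)) ^ k ∈ T := by
    intro x _
    simp only [T, Finset.mem_filter, Finset.mem_univ, true_and]
    rw [← pow_mul, hek, ← hK]
    exact FiniteField.pow_card_sub_one_eq_one _
      (mul_ne_zero hα (add_algebraMap_ne_zero hn hF hK hθ x))
  have hsum : q = ∑ ξ ∈ T, (linePowFiber (F := F) α θ k ξ).card := by
    rw [← hF, ← Finset.card_univ, Finset.card_eq_sum_card_fiberwise hmaps]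
    exact Finset.sum_congr rfl fun ξ _ => by unfold linePowFiber; congr!
  have hζT : ζ ∈ T := by simp [T, hζ]
  rw [← Finset.add_sum_erase _ _ hζT] at hsum
  have hrest : (∑ ξ ∈ T.erase ζ, (linePowFiber (F := F) α θ k ξ).card) * (e * q.sqrt) ≤
      (e - 1) * (q * (q.sqrt + 12 * n * e ^ 2)) := by
    rw [Finset.sum_mul]
    refine (Finset.sum_le_card_nsmul _ _ (q * (q.sqrt + 12 * n * e ^ 2)) fun ξ _ => ?_).trans ?_
    · rw [← mul_assoc]
      exact card_linePowFiber_le hn hF hK hα hθ he hes ξ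
    · rw [smul_eq_mul, Finset.card_erase_of_mem hζT]
      exact Nat.mul_le_mul_right _ (by omega)
  set R := ∑ ξ ∈ T.erase ζ, (linePowFiber (F := F) α θ k ξ).card
  set c := (linePowFiber (F := F) α θ k ζ).card
  obtain ⟨e', rfl⟩ : ∃ e', e = e' + 1 := ⟨e - 1, by omega⟩
  rw [Nat.add_sub_cancel] at hrest
  have h1 : q * ((e' + 1) * q.sqrt) = c * ((e' + 1) * q.sqrt) + R * ((e' + 1) * q.sqrt) := by
    rw [← add_mul, ← hsum]
  have h2 : e' * (q * (12 * n * (e' + 1) ^ 2)) ≤ 12 * n * (e' + 1) ^ 3 * q := by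
    calc _ ≤ (e' + 1) * (q * (12 * n * (e' + 1) ^ 2)) := Nat.mul_le_mul_right _ (by omega)
      _ = _ := by ring
  nlinarith

theorem minpoly_natDegree_eq (hF : Fintype.card F = q) (hK : Fintype.card K = q ^ n) {θ : K}
    (hθ : Algebra.adjoin F {θ} = ⊤) : (minpoly F θ).natDegree = n := by
  have hq : 1 < q := hF ▸ Fintype.one_lt_card
  have hfin : Module.finrank F K = n := by
    have := Module.card_eq_pow_finrank (K := F) (V := K)
    rw [hF, hK] at this
    exact (Nat.pow_right_injective hq this).symm
  have h_integral : IsIntegral F θ := Algebra.IsIntegral.isIntegral θ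
  have htop : IntermediateField.adjoin F {θ} = ⊤ := by
    rw [← IntermediateField.toSubalgebra_inj,
      IntermediateField.adjoin_simple_toSubalgebra_of_isAlgebraic h_integral.isAlgebraic, hθ]
    rfl
  rw [← IntermediateField.adjoin.finrank h_integral, htop, IntermediateField.finrank_top', hfin]

theorem card_linePowFiber_pow_mul_le (hF : Fintype.card F = q)
    (hK : Fintype.card K = q ^ n) {α θ : K} (hα : α ≠ 0) (hθ : Algebra.adjoin F {θ} = ⊤)
    {l : ℕ} (hl : l ∣ q ^ n - 1) (hqn : 1 < q ^ n) :
    ((linePowFiber (F := F) α θ ((q ^ n - 1) / l) 1).card + 1 - n) ^ n * l ≤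
      n.factorial * q ^ n := by
  classical
  have hl0 : 0 < l := Nat.pos_of_dvd_of_pos hl (by omega)
  set k := (q ^ n - 1) / l with hk
  have hlk : k * l = q ^ n - 1 := Nat.div_mul_cancel hl
  have hk0 : 0 < k := Nat.pos_of_mul_pos_right (by rw [hlk]; omega)
  set B := linePowFiber (F := F) α θ k 1
  have hcard : (B.powersetCard n).card ≤ (Finset.univ.filter fun ζ : K => ζ ^ k = 1).card := by
    refine Finset.card_le_card_of_injOn
      (fun S => ∏ x ∈ S, (α * (θ + algebraMap F K x))) ?_ ?_
    · intro S hS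
      rw [Finset.mem_coe, Finset.mem_powersetCard] at hS
      simp only [Finset.coe_filter, Finset.mem_univ, true_and, Set.mem_ofPred_eq]
      rw [← Finset.prod_pow]
      exact Finset.prod_eq_one fun x hx => mem_linePowFiber.mp (hS.1 hx)
    · intro S hS S' hS' h
      rw [Finset.mem_coe, Finset.mem_powersetCard] at hS hS'
      simp only [Finset.prod_mul_distrib, Finset.prod_const, hS.2, hS'.2] at h
      have h := mul_left_cancel₀ (pow_ne_zero n hα) h
      let P : Finset F → F[X] := fun S => ∏ x ∈ S, (X - C (-x))
      have hPm : ∀ S, (P S).Monic := fun S => monic_prod_of_monic _ _ fun x _ => monic_X_sub_C _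
      have hPd : ∀ S, (P S).natDegree = S.card := fun S => by
        simp only [P]
        rw [natDegree_prod_of_monic _ _ fun x _ => monic_X_sub_C _]; simp
      have hPa : ∀ S, aeval θ (P S) = ∏ x ∈ S, (θ + algebraMap F K x) := fun S => by
        simp [P, map_prod]
      have hPP : P S = P S' := by
        by_contra hne
        have h1 : aeval θ (P S - P S') = 0 := by rw [map_sub, hPa, hPa, h, sub_self]
        have h2 := natDegree_le_natDegree
          (minpoly.degree_le_of_ne_zero F θ (sub_ne_zero.mpr hne) h1)
        have h3 : (P S - P S').degree < (P S).degree := by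
          refine degree_sub_lt_left ?_ (hPm S).ne_zero ?_
          · rw [degree_eq_natDegree (hPm S).ne_zero, degree_eq_natDegree (hPm S').ne_zero, hPd,
              hPd, hS.2, hS'.2]
          · rw [(hPm S).leadingCoeff, (hPm S').leadingCoeff]
        have h4 := natDegree_lt_natDegree (sub_ne_zero.mpr hne) h3
        rw [hPd, hS.2] at h4
        rw [minpoly_natDegree_eq hF hK hθ] at h2
        omega
      ext x
      have hroot : ∀ S, x ∈ S ↔ (P S).eval (-x) = 0 := fun S => by
        simp only [P, eval_prod, Finset.prod_eq_zero_iff, eval_sub, eval_X, eval_C, sub_eq_zero,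
          neg_inj]
        exact ⟨fun h => ⟨x, h, rfl⟩, fun ⟨y, h, e⟩ => e ▸ h⟩
      rw [hroot, hroot, hPP]
  rw [Finset.card_powersetCard] at hcard
  have h1 := hcard.trans (card_pow_eq_one_le hk0)
  calc (B.card + 1 - n) ^ n * l ≤ B.card.descFactorial n * l :=
        Nat.mul_le_mul_right _ (Nat.pow_sub_le_descFactorial _ _)
    _ = n.factorial * (B.card.choose n * l) := by
        rw [Nat.descFactorial_eq_factorial_mul_choose]; ring
    _ ≤ n.factorial * (k * l) := Nat.mul_le_mul_left _ (Nat.mul_le_mul_right _ h1)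
    _ ≤ n.factorial * q ^ n := Nat.mul_le_mul_left _ (by omega)

theorem exists_orderOf_eq {P : ℕ} (hP : P ∣ Fintype.card K - 1) : ∃ ζ : K, orderOf ζ = P := by
  classical
  obtain ⟨g, hg⟩ := IsCyclic.exists_ofOrder_eq_natCard (α := Kˣ)
  rw [Nat.card_eq_fintype_card, Fintype.card_units] at hg
  have h0 : orderOf g ≠ 0 := (orderOf_pos g).ne'
  refine ⟨((g ^ (orderOf g / P) : Kˣ) : K), ?_⟩
  rw [orderOf_units]
  exact orderOf_pow_orderOf_div h0 (hg ▸ hP)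

theorem eq_pow_of_pow_eq {G : Type*} [Monoid G] {γ ζ : G} {P l : ℕ} (hP : 0 < P)
    (hlP : l.Coprime P) (h1 : γ ^ P = 1) (h2 : γ ^ l = ζ) : γ = ζ ^ l ^ (P.totient - 1) := by
  rw [← h2, ← pow_mul, ← pow_succ', Nat.sub_add_cancel (Nat.totient_pos.mpr hP),
    pow_eq_pow_mod _ h1, show l ^ P.totient % P = 1 % P from Nat.ModEq.pow_totient hlP,
    ← pow_eq_pow_mod _ h1, pow_one]

theorem card_filter_mul_le_of_large (hn : 2 ≤ n) (hF : Fintype.card F = q)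
    (hK : Fintype.card K = q ^ n) {α θ : K} (hα : α ≠ 0) (hθ : Algebra.adjoin F {θ} = ⊤)
    {l z : ℕ} (hl : l ∣ q ^ n - 1) (hlz : n.factorial * z ^ n ≤ l) (hz : n * z ≤ q) :
    (linePowFiber (F := F) α θ ((q ^ n - 1) / l) 1).card * z ≤ 2 * q := by
  have hq1 : 1 < q := hF ▸ Fintype.one_lt_card
  have hqn : 1 < q ^ n := Nat.one_lt_pow (by omega) hq1
  have h1 := card_linePowFiber_pow_mul_le hF hK hα hθ hl hqn
  set b := (linePowFiber (F := F) α θ ((q ^ n - 1) / l) 1).card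
  have h2 : ((b + 1 - n) * z) ^ n ≤ q ^ n := by
    refine Nat.le_of_mul_le_mul_left ?_ n.factorial_pos
    calc n.factorial * ((b + 1 - n) * z) ^ n = (b + 1 - n) ^ n * (n.factorial * z ^ n) := by
          rw [mul_pow]; ring
      _ ≤ (b + 1 - n) ^ n * l := Nat.mul_le_mul_left _ hlz
      _ ≤ _ := h1
  have h3 : (b + 1 - n) * z ≤ q := (Nat.pow_le_pow_iff_left (by omega)).mp h2
  calc b * z ≤ (n + (b + 1 - n)) * z := Nat.mul_le_mul_right _ (by omega)
    _ = n * z + (b + 1 - n) * z := add_mul _ _ _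
    _ ≤ 2 * q := by omega

open Classical in
theorem card_filter_mul_le_of_medium (hn : 2 ≤ n) (hF : Fintype.card F = q)
    (hK : Fintype.card K = q ^ n) {α θ : K} (hα : α ≠ 0) (hθ : Algebra.adjoin F {θ} = ⊤)
    {r P l : ℕ} {ζ : K} (hlP : l.Coprime P) (he : r * P * l ∣ q ^ n - 1)
    (hs : 12 * n * (r * P * l) ^ 2 ≤ q.sqrt) :
    ((linePowFiber (F := F) α θ ((q ^ n - 1) / (r * P)) ζ).filter fun x =>
      (α * (θ + algebraMap F K x)) ^ ((q ^ n - 1) / (r * l)) = 1).card * (r * P * l) ≤ 2 * q := by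
  have hq1 : 1 < q := hF ▸ Fintype.one_lt_card
  have hqn : 1 < q ^ n := Nat.one_lt_pow (by omega) hq1
  have he0 : 0 < r * P * l := Nat.pos_of_dvd_of_pos he (by omega)
  have hs8 : 8 * n * (r * P * l) ^ 2 ≤ q.sqrt :=
    le_trans (Nat.mul_le_mul_right _ (Nat.mul_le_mul_right _ (by norm_num))) hs
  have hbound := card_linePowFiber_le hn hF hK hα hθ he hs8 (ζ ^ l ^ (P.totient - 1))
  obtain ⟨w, hw⟩ := he
  have hr : 0 < r := by by_contra h; simp_all
  have hP : 0 < P := by by_contra h; simp_all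
  have hl : 0 < l := by by_contra h; simp_all
  rw [hw] at hbound ⊢
  rw [Nat.mul_div_cancel_left _ he0] at hbound
  have hsub : ((linePowFiber (F := F) α θ (r * P * l * w / (r * P)) ζ).filter fun x =>
      (α * (θ + algebraMap F K x)) ^ (r * P * l * w / (r * l)) = 1) ⊆
      linePowFiber (F := F) α θ w (ζ ^ l ^ (P.totient - 1)) := by
    intro x hx
    rw [Finset.mem_filter, mem_linePowFiber] at hx
    rw [mem_linePowFiber]
    refine eq_pow_of_pow_eq hP hlP ?_ ?_
    · rw [← pow_mul, ← hx.2, show r * P * l * w = r * l * (w * P) by ring,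
        Nat.mul_div_cancel_left _ (by positivity)]
    · rw [← pow_mul, ← hx.1, show r * P * l * w = r * P * (w * l) by ring,
        Nat.mul_div_cancel_left _ (by positivity)]
  have hspos : 0 < q.sqrt := Nat.sqrt_pos.mpr (by omega)
  refine Nat.le_of_mul_le_mul_right ?_ hspos
  calc _ ≤ (linePowFiber (F := F) α θ w (ζ ^ l ^ (P.totient - 1))).card * (r * P * l) * q.sqrt :=
        Nat.mul_le_mul_right _ (Nat.mul_le_mul_right _ (Finset.card_le_card hsub))
    _ ≤ q * (q.sqrt + 12 * n * (r * P * l) ^ 2) := hbound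
    _ ≤ q * (q.sqrt + q.sqrt) := Nat.mul_le_mul_left _ (by omega)
    _ = _ := by ring

theorem orderOf_eq_of_fiber {G : Type*} [Monoid G] {β ζ : G} {W P w : ℕ} (hW : 0 < W)
    (hWP : W = w * P) (hζ : orderOf ζ = P) (hβ : β ^ w = ζ)
    (h : ∀ l, l.Prime → l ∣ W → ¬ l ∣ P → β ^ (W / l) ≠ 1) : orderOf β = W := by
  refine orderOf_eq_of_pow_and_pow_div_prime hW ?_ fun l hl hlW => ?_
  · rw [hWP, pow_mul, hβ, ← hζ, pow_orderOf_eq_one]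
  · by_cases hlP : l ∣ P
    · have hP : 0 < P := Nat.pos_of_ne_zero (by rintro rfl; simp at hWP; omega)
      rw [hWP, Nat.mul_div_assoc _ hlP, pow_mul, hβ]
      refine pow_ne_one_of_lt_orderOf ?_ ?_
      · exact (Nat.div_pos (Nat.le_of_dvd hP hlP) hl.pos).ne'
      · rw [hζ]; exact Nat.div_lt_self hP hl.one_lt
    · exact h l hl hlW hlP

theorem exists_orderOf_line_eq (hn : 2 ≤ n) (hF : Fintype.card F = q)
    (hK : Fintype.card K = q ^ n) {α θ : K} (hα : α ≠ 0) (hθ : Algebra.adjoin F {θ} = ⊤)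
    {r y T : ℕ} (hr : 0 < r) (hrN : r ∣ q ^ n - 1) (hy : 0 < y) (hT : T = r * 4 ^ y)
    (h1 : 48 * n * T ^ 3 ≤ q.sqrt) (h2 : 12 * n * (T * (n.factorial * (T ^ 2) ^ n)) ^ 2 ≤ q.sqrt)
    (hω : 8 * (((q ^ n - 1) / r).primeFactors.filter (y < ·)).card ≤ y) :
    ∃ x : F, orderOf (α * (θ + algebraMap F K x)) = (q ^ n - 1) / r := by
  classical
  have hq1 : 1 < q := hF ▸ Fintype.one_lt_card
  have hqn : 1 < q ^ n := Nat.one_lt_pow (by omega) hq1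
  set W := (q ^ n - 1) / r with hW
  have hrW : r * W = q ^ n - 1 := Nat.mul_div_cancel' hrN
  have hW0 : 0 < W := Nat.pos_of_mul_pos_left (by rw [hrW]; omega)
  set small := W.primeFactors.filter (· ≤ y) with hsmall
  set G := W.primeFactors.filter (y < ·) with hG
  set P := ∏ l ∈ small, l with hP
  have hPW : P ∣ W :=
    (Finset.prod_dvd_prod_of_subset _ _ _ (Finset.filter_subset _ _)).trans
      (Nat.prod_primeFactors_dvd W)
  have hP0 : 0 < P := Nat.pos_of_dvd_of_pos hPW hW0
  have hP4 : P ≤ 4 ^ y := by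
    refine le_trans (Nat.le_of_dvd (primorial_pos y) ?_) (primorial_le_four_pow y)
    refine Finset.prod_dvd_prod_of_subset _ _ _ fun l hl => ?_
    simp only [hsmall, Finset.mem_filter, Nat.mem_primeFactors, Finset.mem_range] at hl ⊢
    exact ⟨by omega, hl.1.1⟩
  have hdvdP : ∀ l, l.Prime → l ∣ W → (l ∣ P ↔ l ≤ y) := by
    intro l hl hlW
    constructor
    · intro h
      obtain ⟨l', hl', h'⟩ := (Prime.dvd_finsetProd_iff hl.prime _).mp h
      simp only [hsmall, Finset.mem_filter, Nat.mem_primeFactors] at hl'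
      rw [(Nat.prime_dvd_prime_iff_eq hl hl'.1.1).mp h']
      exact hl'.2
    · intro h
      exact Finset.dvd_prod_of_mem _ (by
        simp only [hsmall, Finset.mem_filter, Nat.mem_primeFactors]
        exact ⟨⟨hl, hlW, hW0.ne'⟩, h⟩)
  have heT : r * P ≤ T := hT ▸ Nat.mul_le_mul_left _ hP4
  have heN : r * P ∣ q ^ n - 1 := hrW ▸ Nat.mul_dvd_mul_left r hPW
  have he0 : 0 < r * P := Nat.mul_pos hr hP0
  have hyT : y ≤ T := by
    rw [hT]
    exact (Nat.lt_pow_self (by norm_num)).le.trans (Nat.le_mul_of_pos_left _ hr)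
  have hs0 : 0 < q.sqrt := Nat.sqrt_pos.mpr (by omega)
  obtain ⟨ζ, hζ⟩ := exists_orderOf_eq (K := K) (P := P)
    (by rw [hK, ← hrW]; exact Dvd.dvd.mul_left hPW r)
  set B := linePowFiber (F := F) α θ ((q ^ n - 1) / (r * P)) ζ with hB
  have hBcard : 3 * q ≤ 4 * (B.card * (r * P)) := by
    have h3 : 48 * n * (r * P) ^ 3 ≤ q.sqrt :=
      (Nat.mul_le_mul_left _ (Nat.pow_le_pow_left heT 3)).trans h1
    have h4 : n * (r * P) ^ 2 ≤ n * (r * P) ^ 3 :=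
      Nat.mul_le_mul_left _ (Nat.pow_le_pow_right he0 (by norm_num))
    have hlow := le_card_linePowFiber hn hF hK hα hθ heN (by lia)
      (ζ := ζ) (by rw [mul_comm, pow_mul, ← hζ, pow_orderOf_eq_one, one_pow])
    have h5 : 48 * n * (r * P) ^ 3 * q ≤ q.sqrt * q := Nat.mul_le_mul_right _ h3
    refine Nat.le_of_mul_le_mul_right ?_ hs0
    lia
  let bad : ℕ → Finset F := fun l => B.filter fun x =>
      (α * (θ + algebraMap F K x)) ^ ((q ^ n - 1) / (r * l)) = 1
  have hbad : ∀ l ∈ G, (bad l).card * (r * P * y) ≤ 2 * q := by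
    intro l hl
    simp only [hG, Finset.mem_filter, Nat.mem_primeFactors] at hl
    obtain ⟨⟨hlp, hlW, -⟩, hyl⟩ := hl
    have hlP : l.Coprime P := (Nat.Prime.coprime_iff_not_dvd hlp).mpr fun h => by
      have := (hdvdP l hlp hlW).mp h
      omega
    by_cases hsize : l ≤ n.factorial * (T ^ 2) ^ n
    · refine le_trans ?_ (card_filter_mul_le_of_medium (l := l) hn hF hK hα hθ hlP ?_ ?_ (ζ := ζ)
        (r := r))
      · exact Nat.mul_le_mul_left _ (Nat.mul_le_mul_left _ hyl.le)
      · rw [← hrW, mul_assoc]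
        exact Nat.mul_dvd_mul_left r (hlP.symm.mul_dvd_of_dvd_of_dvd hPW hlW)
      · exact (Nat.mul_le_mul_left _ (Nat.pow_le_pow_left (Nat.mul_le_mul heT hsize) 2)).trans h2
    · have hT0 : 0 < T := hy.trans_le hyT
      have hz : n * T ^ 2 ≤ q := by
        have : n * T ^ 2 ≤ n * T ^ 3 :=
          Nat.mul_le_mul_left _ (Nat.pow_le_pow_right hT0 (by norm_num))
        have := Nat.sqrt_le_self q
        lia
      have hlN : l ∣ q ^ n - 1 := hrW ▸ Dvd.dvd.mul_left hlW r
      refine le_trans ?_ (card_filter_mul_le_of_large hn hF hK hα hθ hlN (by omega) hz)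
      refine Nat.mul_le_mul (Finset.card_le_card fun x hx => ?_) ?_
      · have hx := (Finset.mem_filter.mp hx).2
        rw [mem_linePowFiber]
        obtain ⟨v, hv⟩ := hlW
        rw [← hrW, hv, ← mul_assoc, Nat.mul_div_cancel_left _ (Nat.mul_pos hr hlp.pos)] at hx
        rw [← hrW, hv, show r * (l * v) = l * (v * r) by ring,
          Nat.mul_div_cancel_left _ hlp.pos, pow_mul, hx, one_pow]
      · rw [sq]; exact Nat.mul_le_mul heT hyT
  have hunion : (G.biUnion bad).card < B.card := by
    have h3 : (G.biUnion bad).card * (r * P * y) ≤ G.card * (2 * q) := by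
      refine (Nat.mul_le_mul_right _ Finset.card_biUnion_le).trans ?_
      rw [Finset.sum_mul]
      exact (Finset.sum_le_card_nsmul _ _ _ hbad)
    have h4 : 4 * ((G.biUnion bad).card * (r * P)) ≤ q := by
      refine Nat.le_of_mul_le_mul_right ?_ hy
      have : 8 * G.card * q ≤ y * q := Nat.mul_le_mul_right _ hω
      lia
    refine Nat.lt_of_mul_lt_mul_right (a := r * P) ?_
    omega
  obtain ⟨x, hxB, hxG⟩ := Finset.exists_mem_notMem_of_card_lt_card hunion
  refine ⟨x, orderOf_eq_of_fiber (P := P) (ζ := ζ) hW0 ?_ hζ (mem_linePowFiber.mp hxB) ?_⟩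
  · rw [← Nat.div_div_eq_div_mul, ← hW, Nat.div_mul_cancel hPW]
  · intro l hl hlW hlP h
    refine hxG (Finset.mem_biUnion.mpr ⟨l, ?_, Finset.mem_filter.mpr ⟨hxB, ?_⟩⟩)
    · rw [hdvdP l hl hlW] at hlP
      simp only [hG, Finset.mem_filter, Nat.mem_primeFactors]
      exact ⟨⟨hl, hlW, hW0.ne'⟩, by omega⟩
    · rw [← Nat.div_div_eq_div_mul, ← hW, h]

end FiniteFields

theorem exists_sieve_parameters (n r : ℕ) (hn : 0 < n) (hr : 0 < r) :
    ∃ L : ℕ, ∀ q, L < q → ∃ y, 0 < y ∧ 48 * n * (r * 4 ^ y) ^ 3 ≤ q.sqrt ∧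
      12 * n * (r * 4 ^ y * (n.factorial * ((r * 4 ^ y) ^ 2) ^ n)) ^ 2 ≤ q.sqrt ∧
      ∀ ω, y ^ ω ≤ q ^ n → 8 * ω ≤ y := by
  set b := 4 * n + 3 with hb
  set c := 4 * b + 1 with hc
  set A := 48 * n * n.factorial ^ 2 with hA
  set Y := (A * r ^ b) ^ 2 + 2 ^ (16 * n * c) with hY
  refine ⟨2 ^ (c * Y), fun q hq => ?_⟩
  have hq0 : q ≠ 0 := Nat.ne_of_gt (Nat.zero_lt_of_lt hq)
  have hc0 : 0 < c := by omega
  set y := Nat.log 2 q / c with hy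
  have hYy : Y ≤ y := by
    rw [hy, Nat.le_div_iff_mul_le hc0, mul_comm]
    exact Nat.le_log_of_pow_le (by norm_num) hq.le
  have hy2 : 2 ^ (16 * n * c) ≤ y := (Nat.le_add_left _ _).trans hYy
  have hyA : (A * r ^ b) ^ 2 ≤ y := (Nat.le_add_right _ _).trans hYy
  have hy0 : 0 < y := lt_of_lt_of_le (by positivity) hy2
  have hlow : 2 ^ (c * y) ≤ q :=
    (Nat.pow_le_pow_right (by norm_num) (Nat.mul_div_le _ _)).trans (Nat.pow_log_le_self 2 hq0)
  have hhigh : q < 2 ^ (c * (y + 1)) := by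
    refine (Nat.lt_pow_succ_log_self (by norm_num) q).trans_le
      (Nat.pow_le_pow_right (by norm_num) ?_)
    exact Nat.lt_mul_div_succ _ hc0
  have hT0 : 0 < r * 4 ^ y := by positivity
  have hmain : A * (r * 4 ^ y) ^ b ≤ q.sqrt := by
    rw [Nat.le_sqrt']
    calc (A * (r * 4 ^ y) ^ b) ^ 2 = (A * r ^ b) ^ 2 * 2 ^ (4 * b * y) := by
          rw [show (2 : ℕ) ^ (4 * b * y) = (4 ^ y) ^ (b * 2) by
            rw [show (4 : ℕ) = 2 ^ 2 by norm_num, ← pow_mul, ← pow_mul]; congr 1; ring]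
          generalize 4 ^ y = t
          ring
      _ ≤ 2 ^ y * 2 ^ (4 * b * y) :=
          Nat.mul_le_mul_right _ (hyA.trans (Nat.lt_pow_self (by norm_num)).le)
      _ = 2 ^ (c * y) := by rw [← pow_add, hc]; ring
      _ ≤ q := hlow
  have hfac : 0 < n.factorial := n.factorial_pos
  refine ⟨y, hy0, le_trans (Nat.mul_le_mul ?_ ?_) hmain, le_trans ?_ hmain, fun ω hω => ?_⟩
  · rw [hA]; exact Nat.le_mul_of_pos_right _ (by positivity)
  · exact Nat.pow_le_pow_right hT0 (by omega)
  · generalize r * 4 ^ y = T at hT0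
    calc 12 * n * (T * (n.factorial * (T ^ 2) ^ n)) ^ 2
        = 12 * n * n.factorial ^ 2 * T ^ (4 * n + 2) := by ring
      _ ≤ A * T ^ b := by
          refine Nat.mul_le_mul ?_ (Nat.pow_le_pow_right hT0 (by omega))
          rw [hA]
          exact Nat.mul_le_mul_right _ (Nat.mul_le_mul_right _ (by norm_num))
  · have h1 : 2 ^ (16 * n * c * ω) < 2 ^ (c * (y + 1) * n) := by
      calc 2 ^ (16 * n * c * ω) = (2 ^ (16 * n * c)) ^ ω := pow_mul _ _ _
        _ ≤ y ^ ω := Nat.pow_le_pow_left hy2 ω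
        _ ≤ q ^ n := hω
        _ < (2 ^ (c * (y + 1))) ^ n := Nat.pow_lt_pow_left hhigh hn.ne'
        _ = _ := (pow_mul _ _ _).symm
    have h2 := (Nat.pow_lt_pow_iff_right (by norm_num)).mp h1
    have h3 : n * c * (16 * ω) < n * c * (y + 1) := by lia
    have h4 := Nat.lt_of_mul_lt_mul_left h3
    omega

theorem stmt_15 (n r : ℕ) (hn : 2 ≤ n) (hr : 1 ≤ r) :
    ∃ L : ℕ, ∀ q : ℕ, IsPrimePow q → L < q → r ∣ q ^ n - 1 →
      ∀ (F K : Type) [Field F] [Field K] [Fintype F] [Fintype K] [Algebra F K],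
        Fintype.card F = q → Fintype.card K = q ^ n →
          ∀ (α : Kˣ) (θ : K), Algebra.adjoin F {θ} = ⊤ →
            ∃ x : F,
              orderOf ((α : K) * (θ + algebraMap F K x)) = (q ^ n - 1) / r := by
  obtain ⟨L, hL⟩ := exists_sieve_parameters n r (by omega) hr
  refine ⟨L, fun q _ hq hrN F K _ _ _ _ _ hF hK α θ hθ => ?_⟩
  obtain ⟨y, hy, h1, h2, h3⟩ := hL q hq
  refine exists_orderOf_line_eq hn hF hK α.ne_zero hθ hr hrN hy rfl h1 h2 (h3 _ ?_)
  have hqn : 1 < q ^ n := hK ▸ Fintype.one_lt_card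
  have hW : 0 < (q ^ n - 1) / r := Nat.div_pos (Nat.le_of_dvd (by omega) hrN) hr
  calc y ^ _ ≤ ∏ l ∈ ((q ^ n - 1) / r).primeFactors.filter (y < ·), l :=
        Finset.pow_card_le_prod _ _ _ fun l hl => (Finset.mem_filter.mp hl).2.le
    _ ≤ (q ^ n - 1) / r := Nat.le_of_dvd hW
        ((Finset.prod_dvd_prod_of_subset _ _ _ (Finset.filter_subset _ _)).trans
          (Nat.prod_primeFactors_dvd _))
    _ ≤ q ^ n := (Nat.div_le_self _ _).trans (Nat.sub_le _ _)
end
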